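/- arXiv:2510.20903 — 2 statements merged into one kernel-verified Lean document; each statement's English description precedes it below -/
import Mathlib

section
/- Fix α ∈ ℝ and σ > 0, and let p̄ and q̄ be the output densities of the Gaussian channel Y = αX + σN (N ~ N(0,I_D) independent of X) with input densities p and q on ℝ^D. Assume p̄ and q̄ are continuously differentiable with well-defined gradients and Laplacians and that ∫ p̄(y) |log q̄(y)| dy < ∞. For r > 0 let S_r denote the sphere of radius r centered at the origin with outward unit normal e(y) = y/‖y‖ and surface measure dS. Then both boundary fluxes vanish: lim_{r→∞} ∫_{S_r} log q̄(y) · ⟨∇p̄(y), e(y)⟩ dS(y) = 0 and lim_{r→∞} ∫_{S_r} (1/2) (p̄(y)/q̄(y)) · ⟨∇q̄(y), e(y)⟩ dS(y) = 0. -/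
open MeasureTheory Real Filter Set
open scoped Topology RealInnerProductSpace ENNReal

noncomputable section

/-- Output density of the Gaussian channel `Y = αX + σN`, `N ~ N(0, I_D)`, with input
density `q` on `ℝ^D`: `q̄(y) = ∫ q(x) (2πσ²)^{−D/2} exp(−‖y − αx‖²/(2σ²)) dx`. -/
def channelOut {D : ℕ} (α σ : ℝ) (q : EuclideanSpace ℝ (Fin D) → ℝ)
    (y : EuclideanSpace ℝ (Fin D)) : ℝ :=
  ∫ x, q x * ((2 * π * σ ^ 2) ^ (-(D : ℝ) / 2) *
    Real.exp (-‖y - α • x‖ ^ 2 / (2 * σ ^ 2)))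

set_option linter.unusedSectionVars false

lemma sphere_piece_bound (n : ℕ) (i : Fin (n+1)) (s : ℝ) (hs : s = 1 ∨ s = -1) (r : ℝ) (hr : 0 < r)
    (x y : EuclideanSpace ℝ (Fin (n+1))) (hx : ‖x‖ = r) (hy : ‖y‖ = r)
    (hxi : r ≤ (n+1) * (s * x i)) (hyi : r ≤ (n+1) * (s * y i)) :
    dist x y ≤ (n + n * (n+1) : ℝ) * dist (fun j : Fin n => x (i.succAbove j))
      (fun j : Fin n => y (i.succAbove j)) := by
  set d := dist (fun j : Fin n => x (i.succAbove j)) (fun j : Fin n => y (i.succAbove j)) with hd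
  have hd0 : 0 ≤ d := dist_nonneg
  have hj : ∀ j : Fin n, |x (i.succAbove j) - y (i.succAbove j)| ≤ d := fun j => by
    have := dist_le_pi_dist (fun j : Fin n => x (i.succAbove j)) (fun j : Fin n => y (i.succAbove j)) j
    rwa [Real.dist_eq] at this
  have hxs : x i ^ 2 + ∑ j, x (i.succAbove j) ^ 2 = r ^ 2 := by
    rw [← hx, EuclideanSpace.real_norm_sq_eq, Fin.sum_univ_succAbove _ i]
  have hys : y i ^ 2 + ∑ j, y (i.succAbove j) ^ 2 = r ^ 2 := by
    rw [← hy, EuclideanSpace.real_norm_sq_eq, Fin.sum_univ_succAbove _ i]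
  have hxb : ∀ k, |x k| ≤ r := fun k => by
    rw [← hx]; simpa using PiLp.norm_apply_le x k
  have hyb : ∀ k, |y k| ≤ r := fun k => by
    rw [← hy]; simpa using PiLp.norm_apply_le y k
  have hsum : |x i ^ 2 - y i ^ 2| ≤ n * (d * (2 * r)) := by
    have : x i ^ 2 - y i ^ 2 = ∑ j, (y (i.succAbove j) ^ 2 - x (i.succAbove j) ^ 2) := by
      rw [Finset.sum_sub_distrib]; linarith
    rw [this]
    refine (Finset.abs_sum_le_sum_abs _ _).trans ?_
    have : ∀ j ∈ (Finset.univ : Finset (Fin n)), |y (i.succAbove j) ^ 2 - x (i.succAbove j) ^ 2| ≤ d * (2 * r) := by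
      intro j _
      rw [sq_sub_sq, abs_mul, mul_comm, abs_sub_comm]
      refine mul_le_mul (hj j) ?_ (abs_nonneg _) hd0
      refine (abs_add_le _ _).trans ?_
      linarith [hxb (i.succAbove j), hyb (i.succAbove j)]
    simpa using Finset.sum_le_sum this
  have hi : |x i - y i| ≤ n * (n+1) * d := by
    have h1 : |x i ^ 2 - y i ^ 2| = (s * x i + s * y i) * |x i - y i| := by
      have hn : (0:ℝ) < n + 1 := by positivity
      have hp : 0 < s * x i := by
        by_contra h
        have := mul_nonpos_of_nonneg_of_nonpos hn.le (not_lt.mp h)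
        linarith
      have hp' : 0 < s * y i := by
        by_contra h
        have := mul_nonpos_of_nonneg_of_nonpos hn.le (not_lt.mp h)
        linarith
      rw [sq_sub_sq, abs_mul]
      congr 1
      have : |x i + y i| = |s * x i + s * y i| := by
        rw [← mul_add, abs_mul]; rcases hs with rfl | rfl <;> simp
      rw [this, abs_of_pos (by linarith)]
    have h2 : 2 * r * |x i - y i| ≤ (n+1) * (n * (d * (2 * r))) := by
      calc 2 * r * |x i - y i| ≤ ((n+1) * (s * x i + s * y i)) * |x i - y i| := by
            refine mul_le_mul_of_nonneg_right (by linarith) (abs_nonneg _)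
        _ = (n+1) * |x i ^ 2 - y i ^ 2| := by rw [h1]; ring
        _ ≤ _ := by gcongr
    have h3 : 2 * r * |x i - y i| ≤ 2 * r * (n * (n+1) * d) := by linarith
    exact le_of_mul_le_mul_left h3 (by positivity)
  have hfin : dist x y ≤ ∑ k, |x k - y k| := by
    rw [EuclideanSpace.dist_eq]
    refine Real.sqrt_le_iff.mpr ⟨by positivity, ?_⟩
    simp_rw [Real.dist_eq]
    exact Finset.sum_sq_le_sq_sum_of_nonneg (fun k _ => abs_nonneg _)
  refine hfin.trans ?_
  rw [Fin.sum_univ_succAbove _ i]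
  have : ∑ j, |x (i.succAbove j) - y (i.succAbove j)| ≤ n * d := by
    simpa using Finset.sum_le_sum (fun j (_ : j ∈ (Finset.univ : Finset (Fin n))) => hj j)
  linarith

lemma sphere_piece_measure (n : ℕ) : ∃ M : ℝ≥0∞, M ≠ ∞ ∧ ∀ (i : Fin (n+1)) (s : ℝ) (_ : s = 1 ∨ s = -1) (r : ℝ) (_ : 0 < r)
    (w : EuclideanSpace ℝ (Fin (n+1))),
    μH[(n:ℝ)] {x | (‖x‖ = r ∧ r ≤ (n+1) * (s * x i)) ∧ dist x w ≤ 1} ≤ M := by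
  let K : NNReal := (n + n * (n+1) : ℕ)
  refine ⟨(K : ℝ≥0∞) ^ (n:ℝ) * ENNReal.ofReal (2 ^ n), by finiteness, ?_⟩
  intro i s hs r hr w
  set A := {x : EuclideanSpace ℝ (Fin (n+1)) | (‖x‖ = r ∧ r ≤ (n+1) * (s * x i)) ∧ dist x w ≤ 1}
  let f : EuclideanSpace ℝ (Fin (n+1)) → (Fin n → ℝ) := fun x j => x (i.succAbove j)
  have hf : ∀ x ∈ A, ∀ y ∈ A, dist x y ≤ K * dist (f x) (f y) := by
    rintro x ⟨⟨hx1, hx2⟩, -⟩ y ⟨⟨hy1, hy2⟩, -⟩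
    have := sphere_piece_bound n i s hs r hr x y hx1 hy1 hx2 hy2
    simpa [K] using this
  have hinj : InjOn f A := by
    intro x hx y hy hxy
    have := hf x hx y hy
    rw [hxy] at this
    simpa using this
  let g := Function.invFunOn f A
  have hg : LeftInvOn g f A := hinj.leftInvOn_invFunOn
  have hA : g '' (f '' A) = A := hg.image_image
  have hL : LipschitzOnWith K g (f '' A) := by
    apply LipschitzOnWith.of_dist_le_mul
    rintro _ ⟨x, hx, rfl⟩ _ ⟨y, hy, rfl⟩
    rw [hg hx, hg hy]
    exact hf x hx y hy
  have h1 := hL.hausdorffMeasure_image_le (d := (n:ℝ)) (by positivity)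
  rw [hA] at h1
  refine h1.trans ?_
  gcongr
  have h2 : f '' A ⊆ Metric.closedBall (f w) 1 := by
    rintro _ ⟨x, hx, rfl⟩
    rw [Metric.mem_closedBall, dist_pi_le_iff zero_le_one]
    intro j
    refine le_trans ?_ hx.2
    rw [Real.dist_eq, dist_eq_norm]
    simpa using PiLp.norm_apply_le (x - w) (i.succAbove j)
  refine (measure_mono h2).trans ?_
  have h3 : (μH[(n:ℝ)] : Measure (Fin n → ℝ)) = volume := by
    simpa using hausdorffMeasure_pi_real (ι := Fin n)
  rw [h3, Real.volume_pi_closedBall _ zero_le_one]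
  simp

lemma sphere_measure (n : ℕ) : ∃ M : ℝ≥0∞, M ≠ ∞ ∧ ∀ (r : ℝ) (_ : 0 < r)
    (w : EuclideanSpace ℝ (Fin (n+1))),
    μH[(n:ℝ)] (Metric.sphere 0 r ∩ Metric.closedBall w 1) ≤ M := by
  obtain ⟨M, hM, h⟩ := sphere_piece_measure n
  refine ⟨∑ i : Fin (n+1), (M + M), ENNReal.sum_ne_top.mpr fun _ _ => by finiteness, ?_⟩
  intro r hr w
  let B : Fin (n+1) → ℝ → Set (EuclideanSpace ℝ (Fin (n+1))) := fun i s =>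
    {x | (‖x‖ = r ∧ r ≤ (n+1) * (s * x i)) ∧ dist x w ≤ 1}
  have hsub : (Metric.sphere 0 r ∩ Metric.closedBall w 1) ⊆
      ⋃ i ∈ (Finset.univ : Finset (Fin (n+1))), (B i 1 ∪ B i (-1)) := by
    rintro x ⟨hx, hxw⟩
    rw [mem_sphere_zero_iff_norm] at hx
    rw [Metric.mem_closedBall] at hxw
    have : ∃ i : Fin (n+1), r ≤ (n+1) * |x i| := by
      by_contra! hc
      have h1 : ∑ i, (n+1) * |x i| < ∑ i : Fin (n+1), r :=
        Finset.sum_lt_sum_of_nonempty Finset.univ_nonempty (fun i _ => hc i)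
      have h2 : ‖x‖ ≤ ∑ k, |x k| := by
        rw [EuclideanSpace.norm_eq]
        refine Real.sqrt_le_iff.mpr ⟨by positivity, ?_⟩
        simp_rw [Real.norm_eq_abs]
        exact Finset.sum_sq_le_sq_sum_of_nonneg (fun k _ => abs_nonneg _)
      rw [← Finset.mul_sum] at h1
      simp only [Finset.sum_const, Finset.card_univ, Fintype.card_fin, nsmul_eq_mul, Nat.cast_add, Nat.cast_one] at h1
      have := lt_of_mul_lt_mul_left h1 (by positivity)
      linarith
    obtain ⟨i, hi⟩ := this
    simp only [mem_iUnion, Finset.mem_univ, exists_prop, true_and]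
    refine ⟨i, ?_⟩
    rcases abs_choice (x i) with h | h
    · left; refine ⟨⟨hx, ?_⟩, hxw⟩; rw [h] at hi; simpa using hi
    · right; refine ⟨⟨hx, ?_⟩, hxw⟩; rw [h] at hi; simpa using hi
  refine (measure_mono hsub).trans ((measure_biUnion_finset_le _ _).trans ?_)
  refine Finset.sum_le_sum fun i _ => (measure_union_le _ _).trans ?_
  exact add_le_add (h i 1 (Or.inl rfl) r hr w) (h i (-1) (Or.inr rfl) r hr w)

lemma sphere_lintegral_tendsto (n : ℕ) (F H : EuclideanSpace ℝ (Fin (n+1)) → ℝ≥0∞) (hH : Measurable H)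
    (hHi : ∫⁻ w, H w ≠ ∞) (C : ℝ≥0∞) (hC : C ≠ ∞)
    (hF : ∀ y, F y ≤ C * ∫⁻ w in Metric.closedBall y 1, H w) :
    Tendsto (fun r : ℝ => ∫⁻ y in Metric.sphere 0 r, F y ∂μH[(n:ℝ)]) atTop (𝓝 0) := by
  obtain ⟨M, hM, hMs⟩ := sphere_measure n
  have key : ∀ r : ℝ, 0 < r → ∫⁻ y in Metric.sphere 0 r, F y ∂μH[(n:ℝ)] ≤
      C * M * ∫⁻ w, {w | r - 1 ≤ ‖w‖}.indicator H w := by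
    intro r hr
    have hfin : μH[(n:ℝ)] (Metric.sphere (0 : EuclideanSpace ℝ (Fin (n+1))) r) < ∞ := by
      apply (isCompact_sphere _ _).measure_lt_top_of_nhdsWithin
      intro x hx
      refine ⟨Metric.sphere 0 r ∩ Metric.closedBall x 1, ?_, (hMs r hr x).trans_lt hM.lt_top⟩
      exact inter_mem self_mem_nhdsWithin (mem_nhdsWithin_of_mem_nhds (Metric.closedBall_mem_nhds x one_pos))
    have : IsFiniteMeasure ((μH[(n:ℝ)]).restrict (Metric.sphere (0 : EuclideanSpace ℝ (Fin (n+1))) r)) :=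
      ⟨by simpa using hfin⟩
    let S : Set (EuclideanSpace ℝ (Fin (n+1)) × EuclideanSpace ℝ (Fin (n+1))) := {z | dist z.2 z.1 ≤ 1}
    have hS : MeasurableSet S := (isClosed_le (by fun_prop) (by fun_prop)).measurableSet
    have hm : Measurable (S.indicator (fun z => H z.2)) := (hH.comp measurable_snd).indicator hS
    calc ∫⁻ y in Metric.sphere 0 r, F y ∂μH[(n:ℝ)]
        ≤ ∫⁻ y in Metric.sphere 0 r, C * (∫⁻ w, S.indicator (fun z => H z.2) (y, w)) ∂μH[(n:ℝ)] := by
          refine lintegral_mono fun y => (hF y).trans_eq ?_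
          rw [← lintegral_indicator Metric.isClosed_closedBall.measurableSet]
          rfl
      _ = C * ∫⁻ y in Metric.sphere 0 r, (∫⁻ w, S.indicator (fun z => H z.2) (y, w)) ∂μH[(n:ℝ)] := by
          rw [lintegral_const_mul' _ _ hC]
      _ = C * ∫⁻ w, ∫⁻ y in Metric.sphere 0 r, S.indicator (fun z => H z.2) (y, w) ∂μH[(n:ℝ)] := by
          rw [lintegral_lintegral_swap]
          exact hm.aemeasurable
      _ ≤ C * ∫⁻ w, M * {w | r - 1 ≤ ‖w‖}.indicator H w := by
          gcongr with w
          have e1 : ∀ y, S.indicator (fun z => H z.2) (y, w) =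
              (Metric.closedBall w 1).indicator (fun _ => H w) y := by
            intro y
            simp only [indicator, S, mem_ofPred_eq, Metric.mem_closedBall, dist_comm]
          simp_rw [e1]
          rw [lintegral_indicator Metric.isClosed_closedBall.measurableSet, lintegral_const,
            Measure.restrict_apply MeasurableSet.univ, univ_inter,
            Measure.restrict_apply Metric.isClosed_closedBall.measurableSet, inter_comm]
          by_cases hw : r - 1 ≤ ‖w‖
          · rw [indicator_of_mem (by exact hw), mul_comm]
            gcongr
            exact hMs r hr w
          · have : Metric.sphere 0 r ∩ Metric.closedBall w 1 = ∅ := by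
              ext y
              simp only [mem_inter_iff, mem_sphere_zero_iff_norm, Metric.mem_closedBall, mem_empty_iff_false, iff_false, not_and]
              intro h1 h2
              apply hw
              rw [dist_eq_norm] at h2
              have := norm_sub_norm_le y w
              linarith
            rw [this]; simp
      _ = _ := by
          rw [lintegral_const_mul' _ _ hM, mul_assoc]
  have hlim : Tendsto (fun r : ℝ => ∫⁻ w, {w : EuclideanSpace ℝ (Fin (n+1)) | r - 1 ≤ ‖w‖}.indicator H w) atTop (𝓝 0) := by
    have : (0 : ℝ≥0∞) = ∫⁻ w : EuclideanSpace ℝ (Fin (n+1)), 0 := by simp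
    rw [this]
    apply tendsto_lintegral_filter_of_dominated_convergence H
    · exact Eventually.of_forall fun r => hH.indicator (measurableSet_le (by fun_prop) (by fun_prop))
    · exact Eventually.of_forall fun r => Eventually.of_forall fun w => indicator_le_self _ _ _
    · exact hHi
    · refine Eventually.of_forall fun w => ?_
      refine tendsto_const_nhds.congr' ?_
      filter_upwards [eventually_gt_atTop (‖w‖ + 1)] with r hr
      rw [indicator_of_notMem]
      simp only [mem_ofPred_eq, not_le]; linarith
  have hlim2 := ENNReal.Tendsto.const_mul hlim (a := C * M) (Or.inr (by finiteness))
  rw [mul_zero] at hlim2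
  refine tendsto_of_tendsto_of_tendsto_of_le_of_le' tendsto_const_nhds hlim2 (Eventually.of_forall fun _ => zero_le) ?_
  filter_upwards [eventually_gt_atTop 0] with r hr using key r hr

section analysis
variable {E : Type*} [NormedAddCommGroup E] [InnerProductSpace ℝ E] [FiniteDimensional ℝ E]
  [MeasurableSpace E] [BorelSpace E]

def uu (σ : ℝ) (y z : E) : ℝ := ‖y - z‖ ^ 2 / (2 * σ ^ 2)

def gm (σ : ℝ) (Q : Measure E) (y : E) : ℝ := ∫ z, Real.exp (-uu σ y z) ∂Q

lemma uu_nonneg (σ : ℝ) (y z : E) : 0 ≤ uu σ y z := by unfold uu; positivity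

lemma uu_continuous (σ : ℝ) : Continuous (fun p : E × E => uu σ p.1 p.2) := by
  unfold uu; fun_prop

lemma uu_cont_left (σ : ℝ) (z : E) : Continuous (fun y => uu σ y z) := by unfold uu; fun_prop
lemma uu_cont_right (σ : ℝ) (y : E) : Continuous (fun z => uu σ y z) := by unfold uu; fun_prop

lemma uu_tri (σ : ℝ) (y w z : E) : uu σ w z ≤ 2 * uu σ y z + 2 * uu σ y w := by
  unfold uu
  rw [← mul_div_assoc, ← mul_div_assoc, ← add_div]
  gcongr
  have h : ‖w - z‖ ≤ ‖y - z‖ + ‖y - w‖ := by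
    have := norm_sub_le (y - z) (y - w)
    rwa [sub_sub_sub_cancel_left] at this
  have h0 := norm_nonneg (w - z)
  nlinarith [sq_nonneg (‖y - z‖ - ‖y - w‖)]

lemma exp_uu_le_one (σ : ℝ) (y z : E) : Real.exp (-uu σ y z) ≤ 1 := by
  rw [Real.exp_le_one_iff]; linarith [uu_nonneg σ y z]

lemma one_add_uu_exp_le (σ : ℝ) (y z : E) : (1 + uu σ y z) * Real.exp (-uu σ y z) ≤ 1 := by
  rw [Real.exp_neg, ← div_eq_mul_inv, div_le_one (Real.exp_pos _)]
  linarith [Real.add_one_le_exp (uu σ y z)]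

lemma norm_le_uu (σ : ℝ) (hσ : 0 < σ) (y z : E) : ‖y - z‖ / σ ^ 2 ≤ 1 / σ * (1 + uu σ y z) := by
  have h : ‖y - z‖ / σ ≤ 1 + uu σ y z := by
    have : uu σ y z = (‖y - z‖ / σ) ^ 2 / 2 := by unfold uu; field_simp
    rw [this]
    nlinarith [sq_nonneg (‖y - z‖ / σ - 1)]
  calc ‖y - z‖ / σ ^ 2 = 1 / σ * (‖y - z‖ / σ) := by field_simp
    _ ≤ _ := by gcongr

lemma integrable_exp_uu (σ : ℝ) (Q : Measure E) [IsFiniteMeasure Q] (y : E) :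
    Integrable (fun z => Real.exp (-uu σ y z)) Q := by
  have hc := uu_cont_right σ y
  refine Integrable.of_bound (C := 1) (by fun_prop) (Eventually.of_forall fun z => ?_)
  rw [Real.norm_of_nonneg (Real.exp_pos _).le]
  exact exp_uu_le_one σ y z

lemma integrable_one_add_uu_exp (σ : ℝ) (Q : Measure E) [IsFiniteMeasure Q] (y : E) :
    Integrable (fun z => (1 + uu σ y z) * Real.exp (-uu σ y z)) Q := by
  have hc := uu_cont_right σ y
  refine Integrable.of_bound (C := 1) (by fun_prop) (Eventually.of_forall fun z => ?_)
  rw [Real.norm_of_nonneg (by have := uu_nonneg σ y z; positivity)]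
  exact one_add_uu_exp_le σ y z

lemma gm_pos (σ : ℝ) (Q : Measure E) [IsProbabilityMeasure Q] (y : E) : 0 < gm σ Q y := by
  unfold gm
  exact integral_exp_pos (integrable_exp_uu σ Q y)

lemma gm_le_one (σ : ℝ) (Q : Measure E) [IsProbabilityMeasure Q] (y : E) : gm σ Q y ≤ 1 := by
  unfold gm
  have := integral_mono (integrable_exp_uu σ Q y) (integrable_const (1:ℝ)) (exp_uu_le_one σ y)
  simpa using this

lemma gm_continuous (σ : ℝ) (Q : Measure E) [IsProbabilityMeasure Q] : Continuous (gm σ Q) := by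
  unfold gm
  refine continuous_of_dominated (bound := fun _ => 1) ?_ ?_ (integrable_const _) ?_
  · intro y; exact (integrable_exp_uu σ Q y).aestronglyMeasurable
  · intro y
    refine Eventually.of_forall fun z => ?_
    rw [Real.norm_of_nonneg (Real.exp_pos _).le]
    exact exp_uu_le_one σ y z
  · refine Eventually.of_forall fun z => ?_
    have := uu_cont_left σ z
    fun_prop

def LL (σ : ℝ) (Q : Measure E) (y : E) : ℝ := - Real.log (gm σ Q y)

lemma LL_nonneg (σ : ℝ) (Q : Measure E) [IsProbabilityMeasure Q] (y : E) : 0 ≤ LL σ Q y := by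
  unfold LL
  have := Real.log_nonpos (gm_pos σ Q y).le (gm_le_one σ Q y)
  linarith

lemma LL_continuous (σ : ℝ) (Q : Measure E) [IsProbabilityMeasure Q] : Continuous (LL σ Q) := by
  unfold LL
  exact ((gm_continuous σ Q).log fun y => (gm_pos σ Q y).ne').neg

/-- Slow variation of `-log` of a Gaussian mixture. -/
lemma LL_tri (σ : ℝ) (Q : Measure E) [IsProbabilityMeasure Q] (y w : E) :
    LL σ Q w ≤ 2 * LL σ Q y + 2 * uu σ y w := by
  have h1 : gm σ Q y ^ 2 * Real.exp (-(2 * uu σ y w)) ≤ gm σ Q w := by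
    set m := gm σ Q y with hm
    have hi := integrable_exp_uu σ Q y
    have h2 : ∀ z, (2 * m * Real.exp (-uu σ y z) - m ^ 2) * Real.exp (-(2 * uu σ y w)) ≤ Real.exp (-uu σ w z) := by
      intro z
      calc _ ≤ (Real.exp (-uu σ y z)) ^ 2 * Real.exp (-(2 * uu σ y w)) := by
            gcongr
            nlinarith [sq_nonneg (Real.exp (-uu σ y z) - m)]
        _ = Real.exp (-(2 * uu σ y z + 2 * uu σ y w)) := by
            rw [← Real.exp_nat_mul, ← Real.exp_add]; congr 1; push_cast; ring
        _ ≤ _ := by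
            rw [Real.exp_le_exp]; linarith [uu_tri σ y w z]
    have h3 := integral_mono (((hi.const_mul (2 * m)).sub (integrable_const (m^2))).mul_const (Real.exp (-(2 * uu σ y w))))
      (integrable_exp_uu σ Q w) h2
    simp only [Pi.sub_apply] at h3
    rw [integral_mul_const, integral_sub (hi.const_mul _) (integrable_const _), integral_const_mul] at h3
    simp only [integral_const, probReal_univ, smul_eq_mul, one_mul] at h3
    change (2 * m * m - m ^ 2) * _ ≤ gm σ Q w at h3
    calc _ = (2 * m * m - m ^ 2) * Real.exp (-(2 * uu σ y w)) := by ring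
      _ ≤ _ := h3
  have hp := gm_pos σ Q y
  have h4 := Real.log_le_log (by positivity) h1
  rw [Real.log_mul (by positivity) (by positivity), Real.log_exp, Real.log_pow] at h4
  unfold LL
  push_cast at h4
  linarith

/-- Entropy-type bound. -/
lemma entropy_bound (σ : ℝ) (Q : Measure E) [IsProbabilityMeasure Q] (y : E) :
    ∫ z, (1 + uu σ y z) * Real.exp (-uu σ y z) ∂Q ≤ (1 + LL σ Q y) * gm σ Q y := by
  set m := gm σ Q y with hm
  have hmp : 0 < m := gm_pos σ Q y
  have hi := integrable_exp_uu σ Q y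
  have h2 : ∀ z, (1 + uu σ y z) * Real.exp (-uu σ y z) ≤ LL σ Q y * Real.exp (-uu σ y z) + m := by
    intro z
    set t := Real.exp (-uu σ y z) with ht
    have htp : 0 < t := Real.exp_pos _
    have hu : uu σ y z = - Real.log t := by rw [ht, Real.log_exp]; ring
    have h := Real.log_le_sub_one_of_pos (div_pos hmp htp)
    rw [Real.log_div hmp.ne' htp.ne'] at h
    have h' : (Real.log m - Real.log t) * t ≤ (m / t - 1) * t := by gcongr
    have h'' : (m / t - 1) * t = m - t := by field_simp
    rw [hu]; unfold LL; rw [← hm]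
    nlinarith
  have h3 := integral_mono (integrable_one_add_uu_exp σ Q y) ((hi.const_mul (LL σ Q y)).add (integrable_const m)) h2
  refine h3.trans_eq ?_
  simp only [Pi.add_apply]
  rw [integral_add (hi.const_mul _) (integrable_const _), integral_const_mul]
  simp only [integral_const, probReal_univ, smul_eq_mul, one_mul]
  change LL σ Q y * m + m = _
  ring

lemma gm_grad (σ : ℝ) (hσ : 0 < σ) (Q : Measure E) [IsProbabilityMeasure Q] (y : E) :
    ‖fderiv ℝ (gm σ Q) y‖ ≤ 1 / σ * ∫ z, (1 + uu σ y z) * Real.exp (-uu σ y z) ∂Q := by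
  let F' : E → E → E →L[ℝ] ℝ := fun y z => Real.exp (-uu σ y z) • (-(1 / σ ^ 2) • innerSL ℝ (y - z))
  have hF' : ∀ y z, ‖F' y z‖ ≤ 1 / σ * ((1 + uu σ y z) * Real.exp (-uu σ y z)) := by
    intro y z
    have h := norm_le_uu σ hσ y z
    simp only [F', norm_smul, innerSL_apply_norm, norm_neg]
    rw [Real.norm_of_nonneg (Real.exp_pos _).le, Real.norm_of_nonneg (by positivity)]
    calc _ = Real.exp (-uu σ y z) * (‖y - z‖ / σ ^ 2) := by ring
      _ ≤ Real.exp (-uu σ y z) * (1 / σ * (1 + uu σ y z)) := by gcongr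
      _ = _ := by ring
  have hd : ∀ y z, HasFDerivAt (fun y => Real.exp (-uu σ y z)) (F' y z) y := by
    intro y z
    have h1 : HasFDerivAt (fun y => ‖y - z‖ ^ 2) (2 • (innerSL ℝ (y - z)).comp (ContinuousLinearMap.id ℝ E)) y :=
      ((hasFDerivAt_id y).sub_const z).norm_sq
    have h2 := ((h1.mul_const (2 * σ ^ 2)⁻¹).neg).exp
    have e : (fun y => Real.exp (-uu σ y z)) = fun y => Real.exp (-(‖y - z‖ ^ 2 * (2 * σ ^ 2)⁻¹)) := by
      funext y; unfold uu; rw [div_eq_mul_inv]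
    rw [e]
    refine h2.congr_fderiv ?_
    ext v
    simp [F', uu]
    field_simp
  have hder : HasFDerivAt (gm σ Q) (∫ z, F' y z ∂Q) y := by
    refine hasFDerivAt_integral_of_dominated_of_fderiv_le (s := univ) (bound := fun _ => 1 / σ) univ_mem
      ?_ (integrable_exp_uu σ Q y) ?_ ?_ (integrable_const _) ?_
    · exact Eventually.of_forall fun x => (integrable_exp_uu σ Q x).aestronglyMeasurable
    · have := uu_cont_right σ y
      refine Continuous.aestronglyMeasurable ?_
      simp only [F']
      fun_prop
    · refine Eventually.of_forall fun z x _ => (hF' x z).trans ?_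
      have := one_add_uu_exp_le σ x z
      calc _ ≤ 1 / σ * 1 := by gcongr
        _ = _ := by ring
    · exact Eventually.of_forall fun z x _ => hd x z
  rw [hder.fderiv, ← integral_const_mul]
  exact norm_integral_le_of_norm_le ((integrable_one_add_uu_exp σ Q y).const_mul _) (Eventually.of_forall fun z => hF' y z)

lemma sq_exp_bound (u : ℝ) (hu : 0 ≤ u) : (1 + u) ^ 2 * Real.exp (-u) ≤ 16 * Real.exp (-(u / 2)) := by
  have h1 : 1 + u ≤ 4 * Real.exp (u / 4) := by linarith [Real.add_one_le_exp (u / 4)]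
  calc (1 + u) ^ 2 * Real.exp (-u) ≤ (4 * Real.exp (u / 4)) ^ 2 * Real.exp (-u) := by gcongr
    _ = 16 * (Real.exp (2 * (u / 4)) * Real.exp (-u)) := by
        rw [mul_pow, ← Real.exp_nat_mul]; push_cast; ring
    _ = _ := by rw [← Real.exp_add]; congr 2; ring

lemma gauss_lintegral (σ b : ℝ) (hσ : 0 < σ) (hb : 0 < b) :
    ∃ c : ℝ≥0∞, c ≠ 0 ∧ c ≠ ∞ ∧ ∀ z : E, ∫⁻ y, ENNReal.ofReal (Real.exp (-(b * uu σ y z))) = c := by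
  have hi : Integrable (fun y : E => Real.exp (-(b * uu σ y 0))) := by
    have h := (GaussianFourier.integrable_cexp_neg_mul_sq_norm_add (V := E) (b := ((b / (2 * σ ^ 2) : ℝ) : ℂ))
      (by rw [Complex.ofReal_re]; positivity) 0 0).norm
    refine h.congr (Eventually.of_forall fun y => ?_)
    simp only [Complex.norm_exp]
    congr 1
    unfold uu
    have : (-((b / (2 * σ ^ 2) : ℝ) : ℂ) * (‖y‖ : ℂ) ^ 2 + 0 * ((⟪(0:E), y⟫ : ℝ) : ℂ)) = ((-(b * (‖y‖ ^ 2 / (2 * σ ^ 2))) : ℝ) : ℂ) := by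
      push_cast; ring
    rw [sub_zero, this, Complex.ofReal_re]
  have hpos := integral_exp_pos (μ := (volume : Measure E)) hi
  refine ⟨∫⁻ y : E, ENNReal.ofReal (Real.exp (-(b * uu σ y 0))), ?_, ?_, ?_⟩
  · rw [← ofReal_integral_eq_lintegral_ofReal hi (Eventually.of_forall fun _ => (Real.exp_pos _).le)]
    simpa using hpos
  · rw [← ofReal_integral_eq_lintegral_ofReal hi (Eventually.of_forall fun _ => (Real.exp_pos _).le)]
    exact ENNReal.ofReal_ne_top
  · intro z
    have := lintegral_sub_right_eq_self (μ := (volume : Measure E)) (fun y => ENNReal.ofReal (Real.exp (-(b * uu σ y 0)))) z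
    rw [← this]
    simp [uu]

end analysis

section analysis2
variable {E : Type*} [NormedAddCommGroup E] [InnerProductSpace ℝ E] [FiniteDimensional ℝ E]
  [MeasurableSpace E] [BorelSpace E]

lemma ofReal_gm (σ : ℝ) (P : Measure E) [IsProbabilityMeasure P] (y : E) :
    ENNReal.ofReal (gm σ P y) = ∫⁻ z, ENNReal.ofReal (Real.exp (-uu σ y z)) ∂P :=
  ofReal_integral_eq_lintegral_ofReal (integrable_exp_uu σ P y)
    (Eventually.of_forall fun _ => (Real.exp_pos _).le)

lemma moment_finite (σ : ℝ) (hσ : 0 < σ) (P Q : Measure E) [IsProbabilityMeasure P] [IsProbabilityMeasure Q]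
    (h : ∫⁻ y, ENNReal.ofReal (gm σ P y * LL σ Q y) ≠ ∞) :
    ∫⁻ z, ENNReal.ofReal (1 + LL σ Q z) ∂P ≠ ∞ := by
  obtain ⟨c, hc0, hc1, hc⟩ := gauss_lintegral (E := E) σ 1 hσ one_pos
  obtain ⟨c', -, hc1', hc'⟩ := gauss_lintegral (E := E) σ (1/2) hσ (by norm_num)
  have hLc := LL_continuous σ Q
  have huc := uu_continuous (E := E) σ
  have hpt : ∀ y z : E, Real.exp (-uu σ y z) * LL σ Q z ≤
      2 * (Real.exp (-uu σ y z) * LL σ Q y) + 32 * Real.exp (-(1/2 * uu σ y z)) := by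
    intro y z
    have h1 := LL_tri σ Q y z
    have h2 := sq_exp_bound _ (uu_nonneg σ y z)
    have hu := uu_nonneg σ y z
    have h3 : uu σ y z * Real.exp (-uu σ y z) ≤ (1 + uu σ y z) ^ 2 * Real.exp (-uu σ y z) := by
      gcongr; nlinarith
    have h4 : Real.exp (-uu σ y z) * LL σ Q z ≤ Real.exp (-uu σ y z) * (2 * LL σ Q y + 2 * uu σ y z) := by
      gcongr
    have h5 : -(1/2 * uu σ y z) = -(uu σ y z / 2) := by ring
    rw [h5]
    linarith
  have key : (∫⁻ z, ENNReal.ofReal (LL σ Q z) ∂P) * c ≤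
      2 * (∫⁻ y, ENNReal.ofReal (gm σ P y * LL σ Q y)) + 32 * c' := by
    calc (∫⁻ z, ENNReal.ofReal (LL σ Q z) ∂P) * c
        = ∫⁻ z, (∫⁻ y, ENNReal.ofReal (Real.exp (-uu σ y z) * LL σ Q z)) ∂P := by
          rw [← lintegral_mul_const' _ _ hc1]
          refine lintegral_congr fun z => ?_
          rw [← hc z, mul_comm, ← lintegral_mul_const' _ _ ENNReal.ofReal_ne_top]
          refine lintegral_congr fun y => ?_
          rw [one_mul, ← ENNReal.ofReal_mul (Real.exp_pos _).le]
      _ ≤ ∫⁻ z, (∫⁻ y, (2 * ENNReal.ofReal (Real.exp (-uu σ y z) * LL σ Q y) +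
            32 * ENNReal.ofReal (Real.exp (-(1/2 * uu σ y z))))) ∂P := by
          refine lintegral_mono fun z => lintegral_mono fun y => ?_
          refine (ENNReal.ofReal_le_ofReal (hpt y z)).trans (ENNReal.ofReal_add_le.trans ?_)
          rw [ENNReal.ofReal_mul zero_le_two, ENNReal.ofReal_mul (by norm_num : (0:ℝ) ≤ 32)]
          simp
      _ = ∫⁻ z, (2 * (∫⁻ y, ENNReal.ofReal (Real.exp (-uu σ y z) * LL σ Q y)) + 32 * c') ∂P := by
          refine lintegral_congr fun z => ?_
          have := uu_cont_left σ z
          rw [lintegral_add_left (by fun_prop), lintegral_const_mul' _ _ (by simp),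
            lintegral_const_mul' _ _ (by simp), hc']
      _ = 2 * (∫⁻ z, (∫⁻ y, ENNReal.ofReal (Real.exp (-uu σ y z) * LL σ Q y)) ∂P) + 32 * c' := by
          rw [lintegral_add_right _ (by fun_prop), lintegral_const_mul' _ _ (by simp)]
          simp
      _ = 2 * (∫⁻ y, (∫⁻ z, ENNReal.ofReal (Real.exp (-uu σ y z) * LL σ Q y) ∂P)) + 32 * c' := by
          rw [lintegral_lintegral_swap]
          apply Measurable.aemeasurable
          unfold Function.uncurry
          have h1 : Measurable (fun p : E × E => uu σ p.2 p.1) := (huc.comp continuous_swap).measurable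
          have h2 : Measurable (fun p : E × E => LL σ Q p.2) := (hLc.comp continuous_snd).measurable
          fun_prop
      _ = _ := by
          congr 2
          refine lintegral_congr fun y => ?_
          rw [ENNReal.ofReal_mul (gm_pos σ P y).le, ofReal_gm, ← lintegral_mul_const' _ _ ENNReal.ofReal_ne_top]
          refine lintegral_congr fun z => ?_
          rw [ENNReal.ofReal_mul (Real.exp_pos _).le]
  have hfin : ∫⁻ z, ENNReal.ofReal (LL σ Q z) ∂P ≠ ∞ := by
    intro htop
    rw [htop, ENNReal.top_mul hc0] at key
    have : 2 * (∫⁻ y, ENNReal.ofReal (gm σ P y * LL σ Q y)) + 32 * c' ≠ ∞ := by finiteness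
    exact this (top_le_iff.mp key)
  have : ∫⁻ z, ENNReal.ofReal (1 + LL σ Q z) ∂P = 1 + ∫⁻ z, ENNReal.ofReal (LL σ Q z) ∂P := by
    simp_rw [fun z => ENNReal.ofReal_add zero_le_one (LL_nonneg σ Q z)]
    rw [lintegral_add_left (by fun_prop)]
    simp
  rw [this]
  finiteness

def HH (σ : ℝ) (P Q : Measure E) (w : E) : ℝ≥0∞ :=
  ∫⁻ z, ENNReal.ofReal ((1 + LL σ Q z) * Real.exp (-(1/4 * uu σ w z))) ∂P

lemma HH_joint (σ : ℝ) (Q : Measure E) [IsProbabilityMeasure Q] :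
    Measurable (fun p : E × E => ENNReal.ofReal ((1 + LL σ Q p.2) * Real.exp (-(1/4 * uu σ p.1 p.2)))) := by
  have h1 : Measurable (fun p : E × E => uu σ p.1 p.2) := (uu_continuous σ).measurable
  have h2 : Measurable (fun p : E × E => LL σ Q p.2) := ((LL_continuous σ Q).comp continuous_snd).measurable
  fun_prop

lemma HH_measurable (σ : ℝ) (P Q : Measure E) [IsProbabilityMeasure P] [IsProbabilityMeasure Q] :
    Measurable (HH σ P Q) := (HH_joint σ Q).lintegral_prod_right'

lemma HH_finite (σ : ℝ) (hσ : 0 < σ) (P Q : Measure E) [IsProbabilityMeasure P] [IsProbabilityMeasure Q]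
    (h : ∫⁻ z, ENNReal.ofReal (1 + LL σ Q z) ∂P ≠ ∞) : ∫⁻ w, HH σ P Q w ≠ ∞ := by
  obtain ⟨c, hc0, hc1, hc⟩ := gauss_lintegral (E := E) σ (1/4) hσ (by norm_num)
  have : ∫⁻ w, HH σ P Q w = (∫⁻ z, ENNReal.ofReal (1 + LL σ Q z) ∂P) * c := by
    unfold HH
    rw [lintegral_lintegral_swap (HH_joint σ Q).aemeasurable, ← lintegral_mul_const' _ _ hc1]
    refine lintegral_congr fun z => ?_
    rw [← hc z, ← lintegral_const_mul' _ _ ENNReal.ofReal_ne_top]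
    refine lintegral_congr fun w => ?_
    rw [ENNReal.ofReal_mul (by linarith [LL_nonneg σ Q z])]
  rw [this]
  finiteness

lemma HH_bound (σ : ℝ) (hσ : 0 < σ) (P Q : Measure E) [IsProbabilityMeasure P] [IsProbabilityMeasure Q] :
    ∃ C : ℝ≥0∞, C ≠ ∞ ∧ ∀ y : E,
      ENNReal.ofReal ((1 + LL σ Q y) * ∫ z, (1 + uu σ y z) * Real.exp (-uu σ y z) ∂P) ≤
        C * ∫⁻ w in Metric.closedBall y 1, HH σ P Q w := by
  set K : ℝ := 32 * Real.exp (1 / (4 * σ ^ 2)) with hK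
  have hK0 : 0 ≤ K := by positivity
  set V : ℝ≥0∞ := volume (Metric.closedBall (0:E) 1) with hV
  have hV0 : V ≠ 0 := (Metric.measure_closedBall_pos volume _ one_pos).ne'
  have hV1 : V ≠ ∞ := measure_closedBall_lt_top.ne
  refine ⟨V⁻¹ * ENNReal.ofReal K, ENNReal.mul_ne_top (ENNReal.inv_ne_top.mpr hV0) ENNReal.ofReal_ne_top, ?_⟩
  intro y
  set Fy := ENNReal.ofReal ((1 + LL σ Q y) * ∫ z, (1 + uu σ y z) * Real.exp (-uu σ y z) ∂P) with hFy
  have h1 : ∀ w ∈ Metric.closedBall y 1, Fy ≤ ENNReal.ofReal K * HH σ P Q w := by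
    intro w hw
    have hpt : ∀ z, (1 + LL σ Q y) * ((1 + uu σ y z) * Real.exp (-uu σ y z)) ≤
        K * ((1 + LL σ Q z) * Real.exp (-(1/4 * uu σ w z))) := by
      intro z
      have hu := uu_nonneg σ y z
      have hLz := LL_nonneg σ Q z
      have hsymm : uu σ z y = uu σ y z := by unfold uu; rw [norm_sub_rev]
      have a1 : 1 + LL σ Q y ≤ 2 * (1 + LL σ Q z) * (1 + uu σ y z) := by
        have := LL_tri σ Q z y
        rw [hsymm] at this
        nlinarith [mul_nonneg hLz hu]
      have a2 : uu σ y w ≤ 1 / (2 * σ ^ 2) := by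
        unfold uu
        gcongr
        rw [Metric.mem_closedBall, dist_comm, dist_eq_norm] at hw
        exact pow_le_one₀ (norm_nonneg _) hw
      have a3 : Real.exp (-(uu σ y z / 2)) ≤ Real.exp (1 / (4 * σ ^ 2)) * Real.exp (-(1/4 * uu σ w z)) := by
        rw [← Real.exp_add, Real.exp_le_exp]
        have := uu_tri σ y w z
        have e : 1 / (4 * σ ^ 2) = 1 / (2 * σ ^ 2) / 2 := by field_simp; norm_num
        rw [e]; linarith
      calc _ ≤ (2 * (1 + LL σ Q z) * (1 + uu σ y z)) * ((1 + uu σ y z) * Real.exp (-uu σ y z)) := by gcongr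
        _ = 2 * (1 + LL σ Q z) * ((1 + uu σ y z) ^ 2 * Real.exp (-uu σ y z)) := by ring
        _ ≤ 2 * (1 + LL σ Q z) * (16 * (Real.exp (1 / (4 * σ ^ 2)) * Real.exp (-(1/4 * uu σ w z)))) := by
            refine mul_le_mul_of_nonneg_left ?_ (by positivity)
            exact (sq_exp_bound _ hu).trans (by gcongr)
        _ = _ := by rw [hK]; ring
    rw [hFy, ← integral_const_mul, ofReal_integral_eq_lintegral_ofReal
      ((integrable_one_add_uu_exp σ P y).const_mul _) (Eventually.of_forall fun z => ?_)]
    · unfold HH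
      rw [← lintegral_const_mul' _ _ ENNReal.ofReal_ne_top]
      refine lintegral_mono fun z => ?_
      rw [← ENNReal.ofReal_mul hK0]
      exact ENNReal.ofReal_le_ofReal (hpt z)
    · have := uu_nonneg σ y z
      have := LL_nonneg σ Q y
      simp only [Pi.zero_apply]
      positivity
  have h2 : Fy * V ≤ ENNReal.ofReal K * ∫⁻ w in Metric.closedBall y 1, HH σ P Q w := by
    have hVy : volume (Metric.closedBall y 1) = V := Measure.addHaar_closedBall_center _ _ _
    rw [← hVy, ← setLIntegral_const, ← lintegral_const_mul' _ _ ENNReal.ofReal_ne_top]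
    exact setLIntegral_mono' Metric.isClosed_closedBall.measurableSet h1
  rw [mul_assoc, mul_comm, ← div_eq_mul_inv]
  exact (ENNReal.le_div_iff_mul_le (Or.inl hV0) (Or.inl hV1)).mpr h2

end analysis2

lemma flux_generic (n : ℕ) (σ : ℝ) (hσ : 0 < σ) (P Q : Measure (EuclideanSpace ℝ (Fin (n+1))))
    [IsProbabilityMeasure P] [IsProbabilityMeasure Q]
    (h : ∫⁻ y, ENNReal.ofReal (gm σ P y * LL σ Q y) ≠ ∞)
    (f : EuclideanSpace ℝ (Fin (n+1)) → ℝ) (K : ℝ) (hK : 0 ≤ K)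
    (hf : ∀ y, |f y| ≤ K * ((1 + LL σ Q y) * ∫ z, (1 + uu σ y z) * Real.exp (-uu σ y z) ∂P)) :
    Tendsto (fun r : ℝ => ∫ y in Metric.sphere 0 r, f y ∂μH[(n:ℝ)]) atTop (𝓝 0) := by
  obtain ⟨C, hC, hb⟩ := HH_bound σ hσ P Q
  have h1 := sphere_lintegral_tendsto n (fun y => ‖f y‖ₑ) (HH σ P Q) (HH_measurable σ P Q)
    (HH_finite σ hσ P Q (moment_finite σ hσ P Q h)) (ENNReal.ofReal K * C) (by finiteness) (by
      intro y
      rw [mul_assoc]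
      refine le_trans ?_ (mul_le_mul_right (hb y) _)
      rw [← ENNReal.ofReal_mul hK, Real.enorm_eq_ofReal_abs]
      exact ENNReal.ofReal_le_ofReal (hf y))
  rw [tendsto_zero_iff_enorm_tendsto_zero]
  exact tendsto_of_tendsto_of_tendsto_of_le_of_le tendsto_const_nhds h1 (fun _ => zero_le)
    (fun r => enorm_integral_le_lintegral_enorm _)


lemma channelOut_eq {D : ℕ} (α σ : ℝ) (q : EuclideanSpace ℝ (Fin D) → ℝ)
    (hq0 : ∀ x, 0 ≤ q x) (hq1 : ∫ x, q x = 1) (hqi : Integrable q) :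
    ∃ Q : Measure (EuclideanSpace ℝ (Fin D)), IsProbabilityMeasure Q ∧
      ∀ y, channelOut α σ q y = (2 * π * σ ^ 2) ^ (-(D : ℝ) / 2) * gm σ Q y := by
  let Q0 : Measure (EuclideanSpace ℝ (Fin D)) := volume.withDensity (fun x => ENNReal.ofReal (q x))
  have hmeas : Measurable (fun x : EuclideanSpace ℝ (Fin D) => α • x) := by fun_prop
  have hQ0 : IsProbabilityMeasure Q0 := by
    constructor
    rw [withDensity_apply _ MeasurableSet.univ, Measure.restrict_univ,
      ← ofReal_integral_eq_lintegral_ofReal hqi (Eventually.of_forall hq0), hq1]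
    simp
  refine ⟨Q0.map (fun x => α • x), Measure.isProbabilityMeasure_map hmeas.aemeasurable, fun y => ?_⟩
  have hc := uu_cont_right σ y
  unfold gm channelOut
  rw [integral_map hmeas.aemeasurable (by fun_prop),
    integral_withDensity_eq_integral_toReal_smul₀ hqi.1.aemeasurable.ennreal_ofReal
      (Eventually.of_forall fun _ => ENNReal.ofReal_lt_top), ← integral_const_mul]
  refine integral_congr_ae (Eventually.of_forall fun x => ?_)
  simp only [ENNReal.toReal_ofReal (hq0 x), smul_eq_mul, uu, neg_div]
  ring

/-- vanishing boundary flux: both boundary-flux integrals over spheres of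
radius `r` (with respect to the `(D−1)`-dimensional surface/Hausdorff measure, outward unit
normal `y/‖y‖`) tend to `0` as `r → ∞`. -/
theorem boundary_flux_vanishes
    (D : ℕ) (α σ : ℝ) (hσ : 0 < σ)
    (p q : EuclideanSpace ℝ (Fin D) → ℝ)
    (hp0 : ∀ x, 0 ≤ p x) (hp1 : ∫ x, p x = 1) (hpi : Integrable p)
    (hq0 : ∀ x, 0 ≤ q x) (hq1 : ∫ x, q x = 1) (hqi : Integrable q)
    -- p̄ and q̄ are continuously differentiable with well-defined gradients and Laplacians
    (hpbar : ContDiff ℝ 2 (channelOut α σ p))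
    (hqbar : ContDiff ℝ 2 (channelOut α σ q))
    -- ∫ p̄(y) |log q̄(y)| dy < ∞
    (hint : Integrable (fun y => channelOut α σ p y * |Real.log (channelOut α σ q y)|)) :
    Tendsto (fun r : ℝ => ∫ y in Metric.sphere (0 : EuclideanSpace ℝ (Fin D)) r,
        Real.log (channelOut α σ q y) *
          ⟪gradient (channelOut α σ p) y, ‖y‖⁻¹ • y⟫ ∂μH[(D : ℝ) - 1])
      atTop (𝓝 0) ∧
    Tendsto (fun r : ℝ => ∫ y in Metric.sphere (0 : EuclideanSpace ℝ (Fin D)) r,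
        (1 / 2) * (channelOut α σ p y / channelOut α σ q y) *
          ⟪gradient (channelOut α σ q) y, ‖y‖⁻¹ • y⟫ ∂μH[(D : ℝ) - 1])
      atTop (𝓝 0) := by
  obtain _ | n := D
  · have hempty : ∀ r : ℝ, 0 < r → Metric.sphere (0 : EuclideanSpace ℝ (Fin 0)) r = ∅ := by
      intro r hr
      exact Metric.sphere_eq_empty_of_subsingleton hr.ne'
    constructor
    · refine tendsto_const_nhds.congr' ?_
      filter_upwards [eventually_gt_atTop 0] with r hr
      rw [hempty r hr]; simp
    · refine tendsto_const_nhds.congr' ?_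
      filter_upwards [eventually_gt_atTop 0] with r hr
      rw [hempty r hr]; simp
  obtain ⟨P, hP, hpP⟩ := channelOut_eq α σ p hp0 hp1 hpi
  obtain ⟨Q, hQ, hqQ⟩ := channelOut_eq α σ q hq0 hq1 hqi
  have hn : (((n + 1 : ℕ) : ℝ) - 1) = n := by push_cast; ring
  rw [hn]
  set c : ℝ := (2 * π * σ ^ 2) ^ (-((n + 1 : ℕ) : ℝ) / 2) with hc
  have hc0 : 0 < c := by positivity
  have hlog : ∀ y, Real.log (channelOut α σ q y) = Real.log c - LL σ Q y := by
    intro y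
    rw [hqQ, Real.log_mul hc0.ne' (gm_pos σ Q y).ne']; unfold LL; ring
  have hgrad : ∀ (Q : Measure (EuclideanSpace ℝ (Fin (n+1)))) [IsProbabilityMeasure Q]
      (q : EuclideanSpace ℝ (Fin (n+1)) → ℝ) (_ : ∀ y, channelOut α σ q y = c * gm σ Q y) y,
      |⟪gradient (channelOut α σ q) y, ‖y‖⁻¹ • y⟫| ≤
        c * (1 / σ * ∫ z, (1 + uu σ y z) * Real.exp (-uu σ y z) ∂Q) := by
    intro Q _ q hq y
    have e : channelOut α σ q = c • gm σ Q := by funext y; rw [hq]; rfl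
    have : Invertible c := invertibleOfNonzero hc0.ne'
    have h1 : ‖gradient (channelOut α σ q) y‖ ≤ c * (1 / σ * ∫ z, (1 + uu σ y z) * Real.exp (-uu σ y z) ∂Q) := by
      unfold gradient
      rw [LinearIsometryEquiv.norm_map, e, fderiv_const_smul_of_invertible, norm_smul, Real.norm_of_nonneg hc0.le]
      exact mul_le_mul_of_nonneg_left (gm_grad σ hσ Q y) hc0.le
    have h2 : ‖‖y‖⁻¹ • y‖ ≤ 1 := by
      rw [norm_smul, norm_inv, norm_norm]
      exact inv_mul_le_one
    refine (abs_real_inner_le_norm _ _).trans ?_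
    refine (mul_le_of_le_one_right (norm_nonneg _) h2).trans h1
  have hJ : ∀ y, gm σ P y ≤ ∫ z, (1 + uu σ y z) * Real.exp (-uu σ y z) ∂P := by
    intro y
    refine integral_mono (integrable_exp_uu σ P y) (integrable_one_add_uu_exp σ P y) fun z => ?_
    have := mul_nonneg (uu_nonneg σ y z) (Real.exp_pos (-uu σ y z)).le
    simp only
    linarith
  have hJ0 : ∀ y, 0 ≤ ∫ z, (1 + uu σ y z) * Real.exp (-uu σ y z) ∂P := fun y =>
    (gm_pos σ P y).le.trans (hJ y)
  have hfin : ∫⁻ y, ENNReal.ofReal (gm σ P y * LL σ Q y) ≠ ∞ := by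
    obtain ⟨k, -, hk1, hk⟩ := gauss_lintegral (E := EuclideanSpace ℝ (Fin (n+1))) σ 1 hσ one_pos
    have hgi : ∫⁻ y, ENNReal.ofReal (gm σ P y) ≠ ∞ := by
      simp_rw [ofReal_gm]
      rw [lintegral_lintegral_swap]
      · simp only [one_mul] at hk
        simp_rw [hk]
        simpa using hk1
      · apply Measurable.aemeasurable
        unfold Function.uncurry
        have h1 := (uu_continuous (E := EuclideanSpace ℝ (Fin (n+1))) σ).measurable
        fun_prop
    have hle : ∀ y, ENNReal.ofReal (gm σ P y * LL σ Q y) ≤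
        ENNReal.ofReal c⁻¹ * ‖channelOut α σ p y * |Real.log (channelOut α σ q y)|‖ₑ +
          ENNReal.ofReal |Real.log c| * ENNReal.ofReal (gm σ P y) := by
      intro y
      have hg := (gm_pos σ P y).le
      rw [Real.enorm_eq_ofReal_abs, ← ENNReal.ofReal_mul (by positivity), ← ENNReal.ofReal_mul (by positivity),
        ← ENNReal.ofReal_add (by positivity) (by positivity)]
      refine ENNReal.ofReal_le_ofReal ?_
      rw [abs_mul, abs_abs, hpP, abs_mul, abs_of_pos hc0, abs_of_nonneg hg]
      have e : c⁻¹ * (c * gm σ P y * |Real.log (channelOut α σ q y)|) = gm σ P y * |Real.log (channelOut α σ q y)| := by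
        field_simp
      rw [e, mul_comm |Real.log c|, ← mul_add]
      refine mul_le_mul_of_nonneg_left ?_ hg
      rw [hlog]
      have := abs_sub_abs_le_abs_sub (LL σ Q y) (Real.log c)
      rw [abs_sub_comm] at this
      linarith [le_abs_self (LL σ Q y)]
    refine ne_top_of_le_ne_top ?_ (lintegral_mono hle)
    rw [lintegral_add_right _ (by have := (gm_continuous σ P).measurable; fun_prop),
      lintegral_const_mul' _ _ (by finiteness), lintegral_const_mul' _ _ (by finiteness)]
    have := hint.2.ne
    finiteness
  constructor
  · refine flux_generic n σ hσ P Q hfin _ ((1 + |Real.log c|) * (c / σ)) (by positivity) fun y => ?_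
    have hL := LL_nonneg σ Q y
    have h1 : |Real.log (channelOut α σ q y)| ≤ (1 + |Real.log c|) * (1 + LL σ Q y) := by
      rw [hlog]
      refine (abs_sub _ _).trans ?_
      rw [abs_of_nonneg hL]
      nlinarith [abs_nonneg (Real.log c), mul_nonneg (abs_nonneg (Real.log c)) hL]
    rw [abs_mul]
    refine (mul_le_mul h1 (hgrad P p hpP y) (abs_nonneg _) (by positivity)).trans_eq ?_
    ring
  · refine flux_generic n σ hσ P Q hfin _ (1 / 2 * (c / σ)) (by positivity) fun y => ?_
    have hL := LL_nonneg σ Q y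
    have hq := gm_pos σ Q y
    have hp := gm_pos σ P y
    rw [abs_mul, hpP, hqQ, mul_div_mul_left _ _ hc0.ne', abs_of_pos (by positivity)]
    calc _ ≤ 1 / 2 * (gm σ P y / gm σ Q y) * (c * (1 / σ * ((1 + LL σ Q y) * gm σ Q y))) := by
          refine mul_le_mul_of_nonneg_left ?_ (by positivity)
          refine (hgrad Q q hqQ y).trans ?_
          have := entropy_bound σ Q y
          gcongr
      _ = 1 / 2 * (c / σ) * ((1 + LL σ Q y) * gm σ P y) := by field_simp
      _ ≤ _ := by
          have := hJ y
          gcongr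
end
end

section
/- Let p be a twice continuously differentiable probability density on ℝ^D with finite second moment, and for σ² ≥ 0 let p_{σ²} = p * φ_σ be its Gaussian smoothing, where φ_σ is the density of N(0, σ² I_D). Assume the Fisher information J(p_{σ²}) is finite and continuous in σ² on [0, σ₁²] and that the differential entropy H(p_{σ²}) is finite on this interval. Then the integrated de Bruijn identity holds: H(p_{σ₁²}) − H(p) = (1/2) ∫_0^{σ₁²} J(p_{σ²}) dσ². -/
open MeasureTheory Real Filter Set
open scoped Topology RealInnerProductSpace

noncomputable section

/-- Gaussian smoothing `p_{σ²} = p * φ_σ`: the convolution of a density `p` on `ℝ^D`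
with the density `φ_σ` of `N(0, σ² I_D)` (with `p_{0} = p`). -/
def gaussSmooth {D : ℕ} (p : EuclideanSpace ℝ (Fin D) → ℝ) (s : ℝ)
    (z : EuclideanSpace ℝ (Fin D)) : ℝ :=
  if s = 0 then p z
  else ∫ x, p x * ((2 * π * s) ^ (-(D : ℝ) / 2) * Real.exp (-‖z - x‖ ^ 2 / (2 * s)))

/-- Differential Shannon entropy `H(p) = −∫ p log p` of a density on `ℝ^D`. -/
def diffEntropy {D : ℕ} (p : EuclideanSpace ℝ (Fin D) → ℝ) : ℝ :=
  -∫ x, p x * Real.log (p x)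

/-- Fisher information `J(p) = ∫ p ‖∇ log p‖²` of a differentiable density on `ℝ^D`. -/
def fisherInfo {D : ℕ} (p : EuclideanSpace ℝ (Fin D) → ℝ) : ℝ :=
  ∫ x, p x * ‖gradient (fun y => Real.log (p y)) x‖ ^ 2


/-! ### Kernel convolution -/

/-- convolution of a density with a kernel -/
def cvl {D : ℕ} (p k : EuclideanSpace ℝ (Fin D) → ℝ) (x : EuclideanSpace ℝ (Fin D)) : ℝ :=
  ∫ y, p y * k (x - y)

/-- the heat kernel -/
def hk (D : ℕ) (s : ℝ) (z : EuclideanSpace ℝ (Fin D)) : ℝ :=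
  (2 * π * s) ^ (-(D : ℝ) / 2) * Real.exp (-‖z‖ ^ 2 / (2 * s))

/-- unnormalised Gaussian -/
def eg (D : ℕ) (c : ℝ) (z : EuclideanSpace ℝ (Fin D)) : ℝ := Real.exp (-c * ‖z‖ ^ 2)

section
variable {D : ℕ}
local notation "𝕍" => EuclideanSpace ℝ (Fin D)

lemma gaussSmooth_pos_eq (p : 𝕍 → ℝ) {s : ℝ} (hs : 0 < s) :
    gaussSmooth p s = cvl p (hk D s) := by
  funext z
  simp [gaussSmooth, cvl, hk, hs.ne']

lemma gaussSmooth_zero (p : 𝕍 → ℝ) : gaussSmooth p 0 = p := by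
  funext z
  simp [gaussSmooth]

lemma eg_pos (c : ℝ) (z : 𝕍) : 0 < eg D c z := Real.exp_pos _

lemma eg_le_one {c : ℝ} (hc : 0 ≤ c) (z : 𝕍) : eg D c z ≤ 1 := by
  unfold eg
  rw [Real.exp_le_one_iff]
  nlinarith [sq_nonneg ‖z‖, mul_nonneg hc (sq_nonneg ‖z‖)]

lemma eg_cont (c : ℝ) : Continuous (eg D c) := by unfold eg; fun_prop

lemma eg_integrable {c : ℝ} (hc : 0 < c) : Integrable (eg D c) := by
  have h := GaussianFourier.integrable_cexp_neg_mul_sq_norm_add (V := 𝕍) (b := (c : ℂ))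
    (by simpa using hc) 0 0
  have h2 := h.norm
  refine h2.congr (Eventually.of_forall fun z => ?_)
  simp only [eg, Complex.norm_exp]
  congr 1
  simp
  left
  norm_cast

lemma one_add_le_exp {c t : ℝ} (hc : 0 < c) (ht : 0 ≤ t) :
    1 + t ≤ (1 + 1 / c) * Real.exp (c * t) := by
  have h1 := Real.add_one_le_exp (c * t)
  have h3 : (1 + 1 / c) * (c * t + 1) ≤ (1 + 1 / c) * Real.exp (c * t) := by gcongr
  have h4 : (1 + 1 / c) * (c * t + 1) = 1 + t + c * t + 1 / c := by field_simp; ring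
  have : 0 < 1 / c := by positivity
  nlinarith [mul_nonneg hc.le ht]

lemma poly_eg {c : ℝ} (hc : 0 < c) (z : 𝕍) :
    (1 + ‖z‖ ^ 2) * eg D c z ≤ (1 + 2 / c) * eg D (c / 2) z := by
  have h := one_add_le_exp (c := c / 2) (t := ‖z‖ ^ 2) (by positivity) (by positivity)
  have e : eg D (c / 2) z = Real.exp (c / 2 * ‖z‖ ^ 2) * eg D c z := by
    unfold eg; rw [← Real.exp_add]; congr 1; ring
  rw [e]
  have := mul_le_mul_of_nonneg_right h (eg_pos c z).le
  have e2 : (1 : ℝ) + 1 / (c / 2) = 1 + 2 / c := by field_simp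
  rw [e2] at this
  linarith

lemma hk_eq (s : ℝ) (z : 𝕍) :
    hk D s z = (2 * π * s) ^ (-(D : ℝ) / 2) * eg D (1 / (2 * s)) z := by
  unfold hk eg; congr 2; ring

lemma hk_pos {s : ℝ} (hs : 0 < s) (z : 𝕍) : 0 < hk D s z := by
  unfold hk; positivity

lemma hk_cont (s : ℝ) : Continuous (hk D s) := by unfold hk; fun_prop

lemma hk_integrable {s : ℝ} (hs : 0 < s) : Integrable (hk D s) := by
  have : hk D s = fun z => (2 * π * s) ^ (-(D : ℝ) / 2) * eg D (1 / (2 * s)) z := by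
    funext z; exact hk_eq s z
  rw [this]
  exact (eg_integrable (by positivity)).const_mul _

lemma hk_integral {s : ℝ} (hs : 0 < s) : ∫ z, hk D s z = 1 := by
  simp_rw [hk_eq]
  rw [integral_const_mul]
  unfold eg
  rw [GaussianFourier.integral_rexp_neg_mul_sq_norm (by positivity)]
  rw [show π / (1 / (2 * s)) = 2 * π * s by field_simp]
  rw [← Real.rpow_add (by positivity)]
  simp
  convert Real.rpow_zero _ using 2
  ring

lemma hk_le_eg {a b s : ℝ} (ha : 0 < a) (has : a ≤ s) (hsb : s ≤ b) (z : 𝕍) :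
    hk D s z ≤ (2 * π * a) ^ (-(D : ℝ) / 2) * eg D (1 / (2 * b)) z := by
  rw [hk_eq]
  have hs : 0 < s := ha.trans_le has
  apply mul_le_mul _ _ (eg_pos _ _).le (by positivity)
  · apply Real.rpow_le_rpow_of_nonpos (by positivity) (by gcongr)
    have : (0 : ℝ) ≤ D := by positivity
    linarith
  · unfold eg
    apply Real.exp_le_exp.2
    have : 1 / (2 * b) ≤ 1 / (2 * s) := by gcongr
    nlinarith [mul_le_mul_of_nonneg_right this (sq_nonneg ‖z‖)]

/-- polynomial times heat kernel is bounded by a Gaussian, locally uniformly in time -/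
lemma poly_hk {a b : ℝ} (ha : 0 < a) (hab : a ≤ b) :
    ∃ C c : ℝ, 0 < C ∧ 0 < c ∧ ∀ s ∈ Icc a b, ∀ z : 𝕍,
      (1 + ‖z‖ ^ 2) * hk D s z ≤ C * eg D c z := by
  have hb : 0 < b := ha.trans_le hab
  refine ⟨(2 * π * a) ^ (-(D : ℝ) / 2) * (1 + 2 / (1 / (2 * b))), 1 / (2 * b) / 2,
    by positivity, by positivity, fun s hs z => ?_⟩
  calc (1 + ‖z‖ ^ 2) * hk D s z
      ≤ (1 + ‖z‖ ^ 2) * ((2 * π * a) ^ (-(D : ℝ) / 2) * eg D (1 / (2 * b)) z) := by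
        gcongr; exact hk_le_eg ha hs.1 hs.2 z
    _ = (2 * π * a) ^ (-(D : ℝ) / 2) * ((1 + ‖z‖ ^ 2) * eg D (1 / (2 * b)) z) := by ring
    _ ≤ (2 * π * a) ^ (-(D : ℝ) / 2) * ((1 + 2 / (1 / (2 * b))) * eg D (1 / (2 * b) / 2) z) := by
        refine mul_le_mul_of_nonneg_left (poly_eg (by positivity) z) (by positivity)
    _ = _ := by ring

/-! convolution facts -/

lemma cvl_eq_conv (p k : 𝕍 → ℝ) :
    cvl p k = MeasureTheory.convolution p k (ContinuousLinearMap.mul ℝ ℝ) volume := by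
  funext x; rfl

lemma cvl_integrable {p k : 𝕍 → ℝ} (hp : Integrable p) (hk : Integrable k) :
    Integrable (cvl p k) := by
  rw [cvl_eq_conv]; exact hp.integrable_convolution _ hk

lemma cvl_integral {p k : 𝕍 → ℝ} (hp : Integrable p) (hk : Integrable k) :
    ∫ x, cvl p k x = (∫ x, p x) * ∫ x, k x := by
  rw [cvl_eq_conv, integral_convolution _ hp hk]; rfl

lemma integrand_integrable {p k : 𝕍 → ℝ} (hp : Integrable p) (hk : Continuous k) {C : ℝ}
    (hC : ∀ z, |k z| ≤ C) (x : 𝕍) : Integrable (fun y => p y * k (x - y)) := by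
  refine hp.mul_bdd (c := C) (by fun_prop) (Eventually.of_forall fun y => ?_)
  exact hC _

lemma cvl_continuous {p k : 𝕍 → ℝ} (hp : Integrable p) (hk : Continuous k) {C : ℝ}
    (hC : ∀ z, |k z| ≤ C) : Continuous (cvl p k) := by
  unfold cvl
  refine continuous_of_dominated (bound := fun y => ‖p y‖ * C)
    (fun x => (integrand_integrable hp hk hC x).aestronglyMeasurable)
    (fun x => Eventually.of_forall fun y => ?_) (hp.norm.mul_const C)
    (Eventually.of_forall fun y => by fun_prop)
  rw [norm_mul]
  gcongr
  exact hC _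

lemma cvl_hasFDerivAt {p k : 𝕍 → ℝ} {k' : 𝕍 → 𝕍 →L[ℝ] ℝ} (hp : Integrable p)
    (hk : ∀ z, HasFDerivAt k (k' z) z) (hk' : Continuous k') {C C' : ℝ}
    (hC : ∀ z, |k z| ≤ C) (hC' : ∀ z, ‖k' z‖ ≤ C') (x : 𝕍) :
    HasFDerivAt (cvl p k) (∫ y, p y • k' (x - y)) x := by
  have hkc : Continuous k := continuous_iff_continuousAt.2 fun z => (hk z).continuousAt
  unfold cvl
  refine hasFDerivAt_integral_of_dominated_of_fderiv_le (s := univ)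
    (F' := fun x y => p y • k' (x - y)) (bound := fun y => ‖p y‖ * C') univ_mem
    (Eventually.of_forall fun x => (integrand_integrable hp hkc hC x).aestronglyMeasurable)
    (integrand_integrable hp hkc hC x) ?_ ?_ (hp.norm.mul_const C') ?_
  · exact hp.aestronglyMeasurable.smul (by fun_prop)
  · refine Eventually.of_forall fun y x _ => ?_
    rw [norm_smul]
    gcongr
    exact hC' _
  · refine Eventually.of_forall fun y x _ => ?_
    have := (hk (x - y)).comp x ((hasFDerivAt_id x).sub_const y)
    simpa using this.const_mul (p y)

lemma cvl_fderiv_apply {p : 𝕍 → ℝ} {k' : 𝕍 → 𝕍 →L[ℝ] ℝ} (hp : Integrable p)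
    (hk' : Continuous k') {C' : ℝ} (hC' : ∀ z, ‖k' z‖ ≤ C') (x v : 𝕍) :
    (∫ y, p y • k' (x - y)) v = cvl p (fun z => k' z v) x := by
  rw [ContinuousLinearMap.integral_apply]
  · simp [cvl]
  · refine (hp.norm.mul_const C').mono' (hp.aestronglyMeasurable.smul (by fun_prop))
      (Eventually.of_forall fun y => ?_)
    rw [norm_smul]
    gcongr
    exact hC' _

/-- key weighted bound -/
lemma cvl_weight {p : 𝕍 → ℝ} (hp : Integrable p) (hp0 : ∀ x, 0 ≤ p x)
    (hpm : Integrable (fun x => ‖x‖ ^ 2 * p x)) {C c : ℝ} (hC : 0 < C) (hc : 0 < c) :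
    ∃ G : 𝕍 → ℝ, Integrable G ∧ ∀ k : 𝕍 → ℝ, Continuous k → (∀ z, |k z| ≤ C * eg D c z) →
      ∀ x, (1 + ‖x‖ ^ 2) * |cvl p k x| ≤ G x := by
  have hq : Integrable (fun y : 𝕍 => (1 + ‖y‖ ^ 2) * p y) := by
    have := hp.add hpm
    refine this.congr (Eventually.of_forall fun y => ?_)
    simp; ring
  refine ⟨fun x => 2 * C * (1 + 2 / c) * cvl (fun y => (1 + ‖y‖ ^ 2) * p y) (eg D (c / 2)) x,
    (cvl_integrable hq (eg_integrable (by positivity))).const_mul _, fun k hk hkb x => ?_⟩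
  have hb : ∀ z, |k z| ≤ C := fun z => (hkb z).trans (by
    have := eg_le_one hc.le z; nlinarith)
  unfold cvl
  beta_reduce
  rw [← integral_const_mul]
  rw [← abs_of_nonneg (show 0 ≤ 1 + ‖x‖ ^ 2 by positivity), ← abs_mul,
    ← integral_const_mul]
  refine (abs_integral_le_integral_abs).trans ?_
  refine integral_mono ?_ ?_ fun y => ?_
  · exact ((integrand_integrable hp hk hb x).const_mul _).abs
  · refine (integrand_integrable hq (eg_cont _) (C := 1) (fun z => ?_) x).const_mul _
    rw [abs_of_pos (eg_pos _ _)]; exact eg_le_one (by positivity) z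
  · have h1 : 1 + ‖x‖ ^ 2 ≤ 2 * ((1 + ‖y‖ ^ 2) * (1 + ‖x - y‖ ^ 2)) := by
      have : ‖x‖ ≤ ‖y‖ + ‖x - y‖ := by
        have := norm_add_le y (x - y); simpa using this
      nlinarith [norm_nonneg x, norm_nonneg y, norm_nonneg (x - y), sq_nonneg (‖y‖ - ‖x - y‖),
        mul_nonneg (sq_nonneg ‖y‖) (sq_nonneg ‖x - y‖), mul_self_le_mul_self (norm_nonneg x) this]
    simp only [abs_mul, abs_of_nonneg (hp0 y)]
    rw [abs_of_nonneg (show 0 ≤ 1 + ‖x‖ ^ 2 by positivity)]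
    have h2 := hkb (x - y)
    have h3 := poly_eg hc (x - y)
    have hpy := hp0 y
    calc (1 + ‖x‖ ^ 2) * (p y * |k (x - y)|)
        ≤ (2 * ((1 + ‖y‖ ^ 2) * (1 + ‖x - y‖ ^ 2))) * (p y * (C * eg D c (x - y))) := by
          gcongr
      _ = 2 * C * (1 + ‖y‖ ^ 2) * p y * ((1 + ‖x - y‖ ^ 2) * eg D c (x - y)) := by ring
      _ ≤ 2 * C * (1 + ‖y‖ ^ 2) * p y * ((1 + 2 / c) * eg D (c / 2) (x - y)) := by
          gcongr
      _ = _ := by ring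

/-! ### derivatives of the heat kernel -/

/-- time derivative of the heat kernel -/
def hkt (D : ℕ) (s : ℝ) (z : (EuclideanSpace ℝ (Fin D))) : ℝ := (‖z‖ ^ 2 / (2 * s ^ 2) - D / (2 * s)) * hk D s z

/-- first partial derivative of the heat kernel -/
def hki (D : ℕ) (s : ℝ) (i : Fin D) (z : (EuclideanSpace ℝ (Fin D))) : ℝ := (-1 / s) * (z i * hk D s z)

/-- second partial derivative of the heat kernel -/
def hkii (D : ℕ) (s : ℝ) (i : Fin D) (z : (EuclideanSpace ℝ (Fin D))) : ℝ := (z i ^ 2 / s ^ 2 - 1 / s) * hk D s z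

/-- differential of the heat kernel -/
def hkD (D : ℕ) (s : ℝ) (z : (EuclideanSpace ℝ (Fin D))) : (EuclideanSpace ℝ (Fin D)) →L[ℝ] ℝ := (-1 / s * hk D s z) • innerSL ℝ z

/-- differential of the first partial derivative -/
def hkiD (D : ℕ) (s : ℝ) (i : Fin D) (z : (EuclideanSpace ℝ (Fin D))) : (EuclideanSpace ℝ (Fin D)) →L[ℝ] ℝ :=
  (-1 / s) • (z i • hkD D s z + hk D s z • (EuclideanSpace.proj i : (EuclideanSpace ℝ (Fin D)) →L[ℝ] ℝ))

lemma hkt_cont (s : ℝ) : Continuous (hkt D s) := by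
  have := hk_cont (D := D) s
  unfold hkt; fun_prop

lemma hki_cont (s : ℝ) (i : Fin D) : Continuous (hki D s i) := by
  have := hk_cont (D := D) s
  unfold hki; fun_prop

lemma hkii_cont (s : ℝ) (i : Fin D) : Continuous (hkii D s i) := by
  have := hk_cont (D := D) s
  unfold hkii; fun_prop

lemma hkD_cont (s : ℝ) : Continuous (hkD D s) := by
  have := hk_cont (D := D) s
  unfold hkD; fun_prop

lemma hkiD_cont (s : ℝ) (i : Fin D) : Continuous (hkiD D s i) := by
  have := hk_cont (D := D) s
  have := hkD_cont (D := D) s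
  unfold hkiD; fun_prop

lemma hkt_eq_sum (s : ℝ) (z : 𝕍) : hkt D s z = 1 / 2 * ∑ i, hkii D s i z := by
  unfold hkt hkii
  rw [← Finset.sum_mul, Finset.sum_sub_distrib, ← Finset.sum_div, ← EuclideanSpace.real_norm_sq_eq]
  simp
  ring

lemma hk_hasFDerivAt (s : ℝ) (z : 𝕍) : HasFDerivAt (hk D s) (hkD D s z) z := by
  have h1 := (hasStrictFDerivAt_norm_sq z).hasFDerivAt
  have h2 := ((h1.const_mul (-1 / (2 * s))).exp).const_mul ((2 * π * s) ^ (-(D : ℝ) / 2))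
  refine (h2.congr_of_eventuallyEq (Eventually.of_forall fun y => ?_)).congr_fderiv ?_
  · simp only [hk]
    congr 2; ring
  · ext v
    have : rexp (-1 / (2 * s) * ‖z‖ ^ 2) = rexp (-‖z‖ ^ 2 / (2 * s)) := by congr 1; ring
    simp only [hkD, hk, this]
    simp
    ring

lemma hki_hasFDerivAt (s : ℝ) (i : Fin D) (z : 𝕍) :
    HasFDerivAt (hki D s i) (hkiD D s i z) z := by
  have h1 : HasFDerivAt (fun z : 𝕍 => z i) (EuclideanSpace.proj i : 𝕍 →L[ℝ] ℝ) z :=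
    (EuclideanSpace.proj i : 𝕍 →L[ℝ] ℝ).hasFDerivAt
  refine ((h1.mul (hk_hasFDerivAt s z)).const_mul (-1 / s)).congr_of_eventuallyEq ?_
  exact Eventually.of_forall fun y => rfl

lemma hkD_apply (s : ℝ) (i : Fin D) (z : 𝕍) :
    hkD D s z (EuclideanSpace.single i 1) = hki D s i z := by
  simp [hkD, hki, EuclideanSpace.inner_single_right]
  ring

lemma hkiD_apply (s : ℝ) (i : Fin D) (z : 𝕍) :
    hkiD D s i z (EuclideanSpace.single i 1) = hkii D s i z := by
  simp [hkiD, hkD_apply]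
  simp [hki, hkii]
  ring

lemma hk_hasDerivAt {s : ℝ} (hs : 0 < s) (z : 𝕍) :
    HasDerivAt (fun s => hk D s z) (hkt D s z) s := by
  have h1 : HasDerivAt (fun s : ℝ => 2 * π * s) (2 * π) s := by
    simpa using (hasDerivAt_id s).const_mul (2 * π)
  have h2 := h1.rpow_const (p := -(D : ℝ) / 2) (Or.inl (by positivity))
  have h3 : HasDerivAt (fun s : ℝ => -‖z‖ ^ 2 / (2 * s)) (‖z‖ ^ 2 / (2 * s ^ 2)) s := by
    have h4 : HasDerivAt (fun s : ℝ => 2 * s) 2 s := by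
      simpa using (hasDerivAt_id s).const_mul 2
    have h5 := (hasDerivAt_const s (-‖z‖ ^ 2)).div h4 (by positivity)
    refine h5.congr_deriv ?_
    field_simp
    ring
  refine (h2.mul h3.exp).congr_deriv ?_
  have h6 : (2 * π * s) ^ (-(D : ℝ) / 2 - 1) = (2 * π * s) ^ (-(D : ℝ) / 2) / (2 * π * s) :=
    Real.rpow_sub_one (by positivity) _
  rw [h6]
  unfold hkt hk
  field_simp
  ring

lemma coord_le (z : 𝕍) (i : Fin D) : |z i| ≤ ‖z‖ := by
  simpa using PiLp.norm_apply_le z i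

lemma coord_sq_le (z : 𝕍) (i : Fin D) : z i ^ 2 ≤ ‖z‖ ^ 2 := by
  have h1 := coord_le z i
  have h2 := abs_nonneg (z i)
  rw [← sq_abs]
  gcongr

lemma norm_le_poly (z : 𝕍) : ‖z‖ ≤ 1 + ‖z‖ ^ 2 := by nlinarith [sq_nonneg (‖z‖ - 1)]

lemma hkt_bound {s : ℝ} (hs : 0 < s) (z : 𝕍) :
    |hkt D s z| ≤ (1 / (2 * s ^ 2) + D / (2 * s)) * ((1 + ‖z‖ ^ 2) * hk D s z) := by
  unfold hkt
  rw [abs_mul, abs_of_pos (hk_pos hs z), ← mul_assoc]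
  have := hk_pos (D := D) hs z
  gcongr
  refine (abs_sub _ _).trans ?_
  rw [abs_of_nonneg (by positivity), abs_of_nonneg (by positivity)]
  have h1 : 0 ≤ 1 / (2 * s ^ 2) := by positivity
  have h2 : 0 ≤ D / (2 * s) := by positivity
  have h3 : ‖z‖ ^ 2 / (2 * s ^ 2) = 1 / (2 * s ^ 2) * ‖z‖ ^ 2 := by ring
  rw [h3]
  nlinarith [mul_nonneg h2 (sq_nonneg ‖z‖)]

lemma hki_bound {s : ℝ} (hs : 0 < s) (i : Fin D) (z : 𝕍) :
    |hki D s i z| ≤ (1 / s) * ((1 + ‖z‖ ^ 2) * hk D s z) := by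
  unfold hki
  have := hk_pos (D := D) hs z
  rw [abs_mul, abs_mul, abs_of_pos this, abs_div, abs_neg, abs_one, abs_of_pos hs]
  gcongr
  exact (coord_le z i).trans (norm_le_poly z)

lemma hkii_bound {s : ℝ} (hs : 0 < s) (i : Fin D) (z : 𝕍) :
    |hkii D s i z| ≤ (1 / s ^ 2 + 1 / s) * ((1 + ‖z‖ ^ 2) * hk D s z) := by
  unfold hkii
  rw [abs_mul, abs_of_pos (hk_pos hs z), ← mul_assoc]
  have := hk_pos (D := D) hs z
  gcongr
  refine (abs_sub _ _).trans ?_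
  rw [abs_of_nonneg (by positivity), abs_of_nonneg (by positivity)]
  have h1 : 0 ≤ 1 / s ^ 2 := by positivity
  have h2 : 0 ≤ 1 / s := by positivity
  have h3 : z i ^ 2 / s ^ 2 = 1 / s ^ 2 * z i ^ 2 := by ring
  rw [h3]
  nlinarith [mul_nonneg h2 (sq_nonneg ‖z‖), mul_le_mul_of_nonneg_left (coord_sq_le z i) h1]

lemma hkD_bound {s : ℝ} (hs : 0 < s) (z : 𝕍) :
    ‖hkD D s z‖ ≤ (1 / s) * (‖z‖ * hk D s z) := by
  unfold hkD
  have := hk_pos (D := D) hs z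
  rw [norm_smul, innerSL_apply_norm, Real.norm_eq_abs, abs_mul, abs_of_pos this, abs_div, abs_neg,
    abs_one, abs_of_pos hs]
  apply le_of_eq; ring

lemma hkiD_bound {s : ℝ} (hs : 0 < s) (i : Fin D) (z : 𝕍) :
    ‖hkiD D s i z‖ ≤ (1 / s ^ 2 + 1 / s) * ((1 + ‖z‖ ^ 2) * hk D s z) := by
  unfold hkiD
  have hp := hk_pos (D := D) hs z
  have h1 : ‖z i • hkD D s z‖ ≤ ‖z‖ * ((1 / s) * (‖z‖ * hk D s z)) := by
    rw [norm_smul]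
    gcongr
    · exact coord_le z i
    · exact hkD_bound hs z
  have h2 : ‖hk D s z • (EuclideanSpace.proj i : 𝕍 →L[ℝ] ℝ)‖ ≤ hk D s z * 1 := by
    rw [norm_smul, Real.norm_eq_abs, abs_of_pos hp]
    gcongr
    refine ContinuousLinearMap.opNorm_le_bound _ zero_le_one fun v => ?_
    simpa using coord_le v i
  rw [norm_smul, Real.norm_eq_abs, abs_div, abs_neg, abs_one, abs_of_pos hs]
  calc 1 / s * ‖z i • hkD D s z + hk D s z • (EuclideanSpace.proj i : 𝕍 →L[ℝ] ℝ)‖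
      ≤ 1 / s * (‖z‖ * ((1 / s) * (‖z‖ * hk D s z)) + hk D s z * 1) := by
        gcongr; exact (norm_add_le _ _).trans (add_le_add h1 h2)
    _ = (1 / s ^ 2 * ‖z‖ ^ 2 + 1 / s) * hk D s z := by field_simp
    _ ≤ ((1 / s ^ 2 + 1 / s) * (1 + ‖z‖ ^ 2)) * hk D s z := by
        gcongr
        have : 0 ≤ 1 / s ^ 2 := by positivity
        have h3 : 0 ≤ 1 / s := by positivity
        nlinarith [mul_nonneg h3 (sq_nonneg ‖z‖)]
    _ = _ := by ring

lemma hk_bound' {s : ℝ} (hs : 0 < s) (z : 𝕍) :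
    |hk D s z| ≤ 1 * ((1 + ‖z‖ ^ 2) * hk D s z) := by
  have := hk_pos (D := D) hs z
  rw [abs_of_pos this]
  nlinarith [mul_nonneg (sq_nonneg ‖z‖) this.le]

/-- all kernels at a fixed time are bounded -/
lemma poly_hk_bdd {s : ℝ} (hs : 0 < s) : ∃ C : ℝ, 0 < C ∧ ∀ z : 𝕍,
    (1 + ‖z‖ ^ 2) * hk D s z ≤ C := by
  obtain ⟨C, c, hC, hc, h⟩ := poly_hk (D := D) hs le_rfl
  refine ⟨C, hC, fun z => (h s ⟨le_rfl, le_rfl⟩ z).trans ?_⟩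
  have := eg_le_one hc.le z
  nlinarith

/-! ### the smoothed density -/

lemma ps_cont {p : 𝕍 → ℝ} (hp : Integrable p) {s : ℝ} (hs : 0 < s) :
    Continuous (cvl p (hk D s)) := by
  obtain ⟨C, hC, h⟩ := poly_hk_bdd (D := D) hs
  exact cvl_continuous hp (hk_cont s) (C := 1 * C) fun z => (hk_bound' hs z).trans (by gcongr; exact h z)

lemma pst_cont {p : 𝕍 → ℝ} (hp : Integrable p) {s : ℝ} (hs : 0 < s) :
    Continuous (cvl p (hkt D s)) := by
  obtain ⟨C, hC, h⟩ := poly_hk_bdd (D := D) hs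
  exact cvl_continuous hp (hkt_cont s) (C := (1 / (2 * s ^ 2) + D / (2 * s)) * C) fun z => (hkt_bound hs z).trans (by gcongr; exact h z)

lemma psi_cont {p : 𝕍 → ℝ} (hp : Integrable p) {s : ℝ} (hs : 0 < s) (i : Fin D) :
    Continuous (cvl p (hki D s i)) := by
  obtain ⟨C, hC, h⟩ := poly_hk_bdd (D := D) hs
  exact cvl_continuous hp (hki_cont s i) (C := (1 / s) * C) fun z => (hki_bound hs i z).trans (by gcongr; exact h z)

lemma psii_cont {p : 𝕍 → ℝ} (hp : Integrable p) {s : ℝ} (hs : 0 < s) (i : Fin D) :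
    Continuous (cvl p (hkii D s i)) := by
  obtain ⟨C, hC, h⟩ := poly_hk_bdd (D := D) hs
  exact cvl_continuous hp (hkii_cont s i) (C := (1 / s ^ 2 + 1 / s) * C) fun z => (hkii_bound hs i z).trans (by gcongr; exact h z)

lemma ps_hasFDerivAt {p : 𝕍 → ℝ} (hp : Integrable p) {s : ℝ} (hs : 0 < s) (x : 𝕍) :
    ∃ L : 𝕍 →L[ℝ] ℝ, HasFDerivAt (cvl p (hk D s)) L x ∧
      ∀ i, L (EuclideanSpace.single i 1) = cvl p (hki D s i) x := by
  obtain ⟨C, hC, h⟩ := poly_hk_bdd (D := D) hs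
  have hb : ∀ z : 𝕍, ‖hkD D s z‖ ≤ 1 / s * C := fun z => (hkD_bound hs z).trans (by
    gcongr
    refine le_trans ?_ (h z)
    have := hk_pos (D := D) hs z
    gcongr
    exact norm_le_poly z)
  refine ⟨_, cvl_hasFDerivAt hp (hk_hasFDerivAt s) (hkD_cont s) (C := 1 * C) (C' := 1 / s * C)
    (fun z => (hk_bound' hs z).trans (by gcongr; exact h z)) hb x, fun i => ?_⟩
  rw [cvl_fderiv_apply hp (hkD_cont s) hb]
  congr 1
  funext z
  exact hkD_apply s i z

lemma psi_hasFDerivAt {p : 𝕍 → ℝ} (hp : Integrable p) {s : ℝ} (hs : 0 < s) (i : Fin D) (x : 𝕍) :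
    ∃ L : 𝕍 →L[ℝ] ℝ, HasFDerivAt (cvl p (hki D s i)) L x ∧
      L (EuclideanSpace.single i 1) = cvl p (hkii D s i) x := by
  obtain ⟨C, hC, h⟩ := poly_hk_bdd (D := D) hs
  have hb : ∀ z : 𝕍, ‖hkiD D s i z‖ ≤ (1 / s ^ 2 + 1 / s) * C :=
    fun z => (hkiD_bound hs i z).trans (by gcongr; exact h z)
  refine ⟨_, cvl_hasFDerivAt hp (hki_hasFDerivAt s i) (hkiD_cont s i) (C := 1 / s * C)
    (C' := (1 / s ^ 2 + 1 / s) * C)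
    (fun z => (hki_bound hs i z).trans (by gcongr; exact h z)) hb x, ?_⟩
  rw [cvl_fderiv_apply hp (hkiD_cont s i) hb]
  congr 1
  funext z
  exact hkiD_apply s i z

lemma psii_sum {p : 𝕍 → ℝ} (hp : Integrable p) {s : ℝ} (hs : 0 < s) (x : 𝕍) :
    cvl p (hkt D s) x = 1 / 2 * ∑ i, cvl p (hkii D s i) x := by
  obtain ⟨C, hC, h⟩ := poly_hk_bdd (D := D) hs
  unfold cvl
  rw [← integral_finsetSum, ← integral_const_mul]
  · congr 1; funext y
    rw [hkt_eq_sum, ← Finset.mul_sum]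
    ring
  · intro i _
    exact integrand_integrable hp (hkii_cont s i) (C := (1 / s ^ 2 + 1 / s) * C)
      (fun z => (hkii_bound hs i z).trans (by gcongr; exact h z)) x

/-- time-derivative bound, locally uniform -/
lemma hkt_unif {a b : ℝ} (ha : 0 < a) (hab : a ≤ b) :
    ∃ C c : ℝ, 0 < C ∧ 0 < c ∧ ∀ s ∈ Icc a b, ∀ z : 𝕍, |hkt D s z| ≤ C * eg D c z := by
  obtain ⟨C, c, hC, hc, h⟩ := poly_hk (D := D) ha hab
  refine ⟨(1 / (2 * a ^ 2) + D / (2 * a)) * C, c, by positivity, hc, fun s hs z => ?_⟩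
  have hs0 : 0 < s := ha.trans_le hs.1
  refine (hkt_bound hs0 z).trans ?_
  rw [mul_assoc]
  have := hk_pos (D := D) hs0 z
  refine mul_le_mul ?_ (h s hs z) (by positivity) (by positivity)
  have := hs.1
  gcongr

lemma ps_hasDerivAt {p : 𝕍 → ℝ} (hp : Integrable p) {s : ℝ} (hs : 0 < s) (x : 𝕍) :
    HasDerivAt (fun s => cvl p (hk D s) x) (cvl p (hkt D s) x) s := by
  obtain ⟨C, c, hC, hc, h⟩ := hkt_unif (D := D) (a := s / 2) (b := 2 * s) (by linarith)
    (by linarith)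
  have hn : Icc (s / 2) (2 * s) ∈ 𝓝 s := Icc_mem_nhds (by linarith) (by linarith)
  have hb : ∀ r ∈ Icc (s / 2) (2 * s), ∀ z : 𝕍, |hkt D r z| ≤ C := fun r hr z =>
    (h r hr z).trans (by have := eg_le_one hc.le z; nlinarith)
  have hint : ∀ r, 0 < r → Integrable (fun y => p y * hk D r (x - y)) := fun r hr => by
    obtain ⟨C, hC, h⟩ := poly_hk_bdd (D := D) hr
    exact integrand_integrable hp (hk_cont r) (C := 1 * C)
      (fun z => (hk_bound' hr z).trans (by gcongr; exact h z)) x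
  unfold cvl
  refine (hasDerivAt_integral_of_dominated_loc_of_deriv_le (s := Icc (s / 2) (2 * s))
    (F := fun r y => p y * hk D r (x - y)) (F' := fun r y => p y * hkt D r (x - y))
    (bound := fun y => ‖p y‖ * C) hn ?_ (hint s hs) ?_ ?_ (hp.norm.mul_const C) ?_).2
  · filter_upwards [lt_mem_nhds hs] with r hr
    exact (hint r hr).aestronglyMeasurable
  · have := hkt_cont (D := D) s
    exact hp.aestronglyMeasurable.mul (by fun_prop)
  · refine Eventually.of_forall fun y r hr => ?_
    rw [norm_mul]
    gcongr
    exact hb r hr _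
  · refine Eventually.of_forall fun y r hr => ?_
    exact (hk_hasDerivAt (by linarith [hr.1]) (x - y)).const_mul (p y)

lemma ps_integrand {p : 𝕍 → ℝ} (hp : Integrable p) {s : ℝ} (hs : 0 < s) (x : 𝕍) :
    Integrable (fun y => p y * hk D s (x - y)) := by
  obtain ⟨C, hC, h⟩ := poly_hk_bdd (D := D) hs
  exact integrand_integrable hp (hk_cont s) (C := 1 * C)
    (fun z => (hk_bound' hs z).trans (by gcongr; exact h z)) x

lemma hk_lower {a b s : ℝ} (ha : 0 < a) (has : a ≤ s) (hsb : s ≤ b) (x y : 𝕍) :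
    (2 * π * b) ^ (-(D : ℝ) / 2) * (eg D (1 / a) x * eg D (1 / a) y) ≤ hk D s (x - y) := by
  have hs : 0 < s := ha.trans_le has
  rw [hk_eq]
  apply mul_le_mul _ _ (mul_pos (eg_pos _ _) (eg_pos _ _)).le (by positivity)
  · apply Real.rpow_le_rpow_of_nonpos (by positivity) (by gcongr)
    have : (0 : ℝ) ≤ D := by positivity
    linarith
  · unfold eg
    rw [← Real.exp_add]
    apply Real.exp_le_exp.2
    have h1 : 1 / (2 * s) ≤ 1 / (2 * a) := by gcongr
    have h2 : ‖x - y‖ ^ 2 ≤ 2 * ‖x‖ ^ 2 + 2 * ‖y‖ ^ 2 := by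
      have := norm_sub_le x y
      nlinarith [norm_nonneg x, norm_nonneg y, norm_nonneg (x - y), sq_nonneg (‖x‖ - ‖y‖)]
    have h3 : 1 / (2 * s) * ‖x - y‖ ^ 2 ≤ 1 / (2 * a) * (2 * ‖x‖ ^ 2 + 2 * ‖y‖ ^ 2) := by
      gcongr
    have h4 : 1 / (2 * a) * (2 * ‖x‖ ^ 2 + 2 * ‖y‖ ^ 2) = 1 / a * ‖x‖ ^ 2 + 1 / a * ‖y‖ ^ 2 := by
      field_simp
    linarith

lemma ps_lower {p : 𝕍 → ℝ} (hp : Integrable p) (hp0 : ∀ x, 0 ≤ p x) (hp1 : ∫ x, p x = 1)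
    {a b : ℝ} (ha : 0 < a) (hab : a ≤ b) :
    ∃ c : ℝ, 0 < c ∧ ∀ s ∈ Icc a b, ∀ x : 𝕍, c * eg D (1 / a) x ≤ cvl p (hk D s) x := by
  have hb : 0 < b := ha.trans_le hab
  have hint : Integrable (fun y : 𝕍 => p y * eg D (1 / a) y) := by
    refine hp.mul_bdd (c := 1) (eg_cont _).aestronglyMeasurable (Eventually.of_forall fun y => ?_)
    rw [Real.norm_eq_abs, abs_of_pos (eg_pos _ _)]
    exact eg_le_one (by positivity) _
  have hpos : 0 < ∫ y, p y * eg D (1 / a) y := by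
    rw [integral_pos_iff_support_of_nonneg (fun y => mul_nonneg (hp0 y) (eg_pos _ _).le) hint]
    have : Function.support (fun y : 𝕍 => p y * eg D (1 / a) y) = Function.support p := by
      ext y; simp [(eg_pos a⁻¹ y).ne']
    rw [this, ← integral_pos_iff_support_of_nonneg hp0 hp, hp1]
    exact one_pos
  refine ⟨(2 * π * b) ^ (-(D : ℝ) / 2) * ∫ y, p y * eg D (1 / a) y, by positivity,
    fun s hs x => ?_⟩
  have : (2 * π * b) ^ (-(D : ℝ) / 2) * (∫ y, p y * eg D (1 / a) y) * eg D (1 / a) x =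
      ∫ y, ((2 * π * b) ^ (-(D : ℝ) / 2) * eg D (1 / a) x) * (p y * eg D (1 / a) y) := by
    rw [integral_const_mul]; ring
  rw [this]
  refine integral_mono (hint.const_mul _) (ps_integrand hp (ha.trans_le hs.1) x) fun y => ?_
  have := mul_le_mul_of_nonneg_left (hk_lower ha hs.1 hs.2 x y) (hp0 y)
  beta_reduce
  linarith

lemma ps_pos {p : 𝕍 → ℝ} (hp : Integrable p) (hp0 : ∀ x, 0 ≤ p x) (hp1 : ∫ x, p x = 1)
    {s : ℝ} (hs : 0 < s) (x : 𝕍) : 0 < cvl p (hk D s) x := by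
  obtain ⟨c, hc, h⟩ := ps_lower hp hp0 hp1 hs le_rfl
  exact (mul_pos hc (eg_pos _ _)).trans_le (h s ⟨le_rfl, le_rfl⟩ x)

lemma ps_log_bound {p : 𝕍 → ℝ} (hp : Integrable p) (hp0 : ∀ x, 0 ≤ p x) (hp1 : ∫ x, p x = 1)
    {a b : ℝ} (ha : 0 < a) (hab : a ≤ b) :
    ∃ C : ℝ, 0 < C ∧ ∀ s ∈ Icc a b, ∀ x : 𝕍,
      |1 + Real.log (cvl p (hk D s) x)| ≤ C * (1 + ‖x‖ ^ 2) := by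
  obtain ⟨c, hc, h⟩ := ps_lower hp hp0 hp1 ha hab
  set M : ℝ := (2 * π * a) ^ (-(D : ℝ) / 2) with hM
  have hM0 : 0 < M := by positivity
  refine ⟨1 + |Real.log M| + |Real.log c| + 1 / a, by positivity, fun s hs x => ?_⟩
  have hs0 : 0 < s := ha.trans_le hs.1
  have hpos := ps_pos hp hp0 hp1 hs0 x
  have hup : cvl p (hk D s) x ≤ M := by
    calc cvl p (hk D s) x ≤ ∫ y, p y * M := by
          refine integral_mono (ps_integrand hp hs0 x) (hp.mul_const _) fun y => ?_
          refine mul_le_mul_of_nonneg_left ?_ (hp0 y)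
          refine (hk_le_eg ha hs.1 hs.2 _).trans ?_
          have hb : 0 < b := ha.trans_le hab
          exact mul_le_of_le_one_right hM0.le (eg_le_one (by positivity) _)
      _ = M := by rw [integral_mul_const, hp1, one_mul]
  have h1 : Real.log (cvl p (hk D s) x) ≤ Real.log M := Real.log_le_log hpos hup
  have h2 : Real.log c - 1 / a * ‖x‖ ^ 2 ≤ Real.log (cvl p (hk D s) x) := by
    have := Real.log_le_log (mul_pos hc (eg_pos _ _)) (h s hs x)
    rw [Real.log_mul hc.ne' (eg_pos _ _).ne'] at this
    unfold eg at this
    rw [Real.log_exp] at this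
    linarith
  have h3 := le_abs_self (Real.log M)
  have h4 := neg_abs_le (Real.log c)
  have h5 : 0 ≤ 1 / a := by positivity
  have h6 := abs_nonneg (Real.log M)
  have h7 := abs_nonneg (Real.log c)
  have h8 : 0 ≤ ‖x‖ ^ 2 := by positivity
  have h9 := mul_nonneg h6 h8
  have h10 := mul_nonneg h7 h8
  have h11 := mul_nonneg h5 h8
  rw [abs_le]
  constructor <;> nlinarith

lemma grad_coord {f : 𝕍 → ℝ} {L : 𝕍 →L[ℝ] ℝ} {x : 𝕍} (h : HasFDerivAt f L x) (i : Fin D) :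
    (gradient f x) i = L (EuclideanSpace.single i 1) := by
  have h1 : gradient f x = (InnerProductSpace.toDual ℝ 𝕍).symm L := by
    rw [gradient, h.fderiv]
  have h2 : inner ℝ ((InnerProductSpace.toDual ℝ 𝕍).symm L) (EuclideanSpace.single i (1 : ℝ)) =
      L (EuclideanSpace.single i 1) := InnerProductSpace.toDual_symm_apply
  rw [← h2, ← h1, EuclideanSpace.inner_single_right]
  simp

/-- Fisher integrand formula -/
lemma fisher_integrand {p : 𝕍 → ℝ} (hp : Integrable p) (hp0 : ∀ x, 0 ≤ p x)
    (hp1 : ∫ x, p x = 1) {s : ℝ} (hs : 0 < s) (x : 𝕍) :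
    cvl p (hk D s) x * ‖gradient (fun y => Real.log (cvl p (hk D s) y)) x‖ ^ 2 =
      ∑ i, cvl p (hki D s i) x ^ 2 / cvl p (hk D s) x := by
  have hpos := ps_pos hp hp0 hp1 hs x
  obtain ⟨L, hL, hLi⟩ := ps_hasFDerivAt hp hs x
  have h1 := hL.log hpos.ne'
  rw [EuclideanSpace.real_norm_sq_eq, Finset.mul_sum]
  refine Finset.sum_congr rfl fun i _ => ?_
  rw [grad_coord h1 i]
  simp only [smul_apply, hLi, smul_eq_mul]
  field_simp

lemma weight_int {p : 𝕍 → ℝ} (hp : Integrable p) (hp0 : ∀ x, 0 ≤ p x) (hp1 : ∫ x, p x = 1)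
    (hpm : Integrable (fun x => ‖x‖ ^ 2 * p x)) {s : ℝ} (hs : 0 < s) {k : 𝕍 → ℝ}
    (hk1 : Continuous k) {C : ℝ} (hC : 0 < C)
    (hkb : ∀ z, |k z| ≤ C * ((1 + ‖z‖ ^ 2) * hk D s z)) :
    Integrable (fun x => (1 + Real.log (cvl p (hk D s) x)) * cvl p k x) := by
  obtain ⟨C1, c, hC1, hc, h1⟩ := poly_hk (D := D) hs le_rfl
  obtain ⟨C2, hC2, h2⟩ := ps_log_bound hp hp0 hp1 hs le_rfl
  have hkb' : ∀ z, |k z| ≤ (C * C1) * eg D c z := fun z => (hkb z).trans (by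
    rw [mul_assoc]; exact mul_le_mul_of_nonneg_left (h1 s ⟨le_rfl, le_rfl⟩ z) hC.le)
  obtain ⟨G, hG, h3⟩ := cvl_weight hp hp0 hpm (C := C * C1) (c := c) (by positivity) hc
  have hcont : Continuous (cvl p k) := cvl_continuous hp hk1 (C := C * C1) fun z =>
    (hkb' z).trans (mul_le_of_le_one_right (by positivity) (eg_le_one hc.le z))
  have hlog : Continuous (fun x => Real.log (cvl p (hk D s) x)) :=
    (ps_cont hp hs).log fun x => (ps_pos hp hp0 hp1 hs x).ne'
  refine (hG.const_mul C2).mono' (by fun_prop) (Eventually.of_forall fun x => ?_)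
  rw [norm_mul, Real.norm_eq_abs, Real.norm_eq_abs]
  calc |1 + Real.log (cvl p (hk D s) x)| * |cvl p k x|
      ≤ (C2 * (1 + ‖x‖ ^ 2)) * |cvl p k x| := by
        gcongr; exact h2 s ⟨le_rfl, le_rfl⟩ x
    _ = C2 * ((1 + ‖x‖ ^ 2) * |cvl p k x|) := by ring
    _ ≤ C2 * G x := by gcongr; exact h3 k hk1 hkb' x

lemma ibp {p : 𝕍 → ℝ} (hp : Integrable p) (hp0 : ∀ x, 0 ≤ p x) (hp1 : ∫ x, p x = 1)
    (hpm : Integrable (fun x => ‖x‖ ^ 2 * p x)) {s : ℝ} (hs : 0 < s)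
    (hJ : Integrable (fun x => cvl p (hk D s) x *
        ‖gradient (fun y => Real.log (cvl p (hk D s) y)) x‖ ^ 2)) :
    ∫ x, (1 + Real.log (cvl p (hk D s) x)) * cvl p (hkt D s) x =
      -(1 / 2 * fisherInfo (cvl p (hk D s))) := by
  have hpos := ps_pos hp hp0 hp1 hs
  have hJi : ∀ i, Integrable (fun x => cvl p (hki D s i) x ^ 2 / cvl p (hk D s) x) := by
    intro i
    have hc1 := psi_cont hp hs i
    have hc2 := ps_cont hp hs
    have hc : Continuous (fun x => cvl p (hki D s i) x ^ 2 / cvl p (hk D s) x) :=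
      (hc1.pow 2).div hc2 fun x => (hpos x).ne'
    refine hJ.mono' hc.aestronglyMeasurable (Eventually.of_forall fun x => ?_)
    rw [fisher_integrand hp hp0 hp1 hs x, Real.norm_eq_abs,
      abs_of_nonneg (div_nonneg (sq_nonneg _) (hpos x).le)]
    exact Finset.single_le_sum (f := fun i => cvl p (hki D s i) x ^ 2 / cvl p (hk D s) x)
      (fun j _ => div_nonneg (sq_nonneg _) (hpos x).le) (Finset.mem_univ i)
  have hii : ∀ i, Integrable (fun x => (1 + Real.log (cvl p (hk D s) x)) * cvl p (hkii D s i) x) :=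
    fun i => weight_int hp hp0 hp1 hpm hs (hkii_cont s i) (by positivity) (hkii_bound hs i)
  have hi : ∀ i, Integrable (fun x => (1 + Real.log (cvl p (hk D s) x)) * cvl p (hki D s i) x) :=
    fun i => weight_int hp hp0 hp1 hpm hs (hki_cont s i) (by positivity) (hki_bound hs i)
  have key : ∀ i, ∫ x, (1 + Real.log (cvl p (hk D s) x)) * cvl p (hkii D s i) x =
      -∫ x, cvl p (hki D s i) x ^ 2 / cvl p (hk D s) x := by
    intro i
    have h1 : ∀ x, HasLineDerivAt ℝ (fun x => 1 + Real.log (cvl p (hk D s) x))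
        (cvl p (hki D s i) x / cvl p (hk D s) x) x (EuclideanSpace.single i 1) := by
      intro x
      obtain ⟨L, hL, hLi⟩ := ps_hasFDerivAt hp hs x
      have h1 := (((hL.log (hpos x).ne').const_add 1).hasLineDerivAt (EuclideanSpace.single i 1))
      have e0 : cvl p (hki D s i) x / cvl p (hk D s) x =
          ((cvl p (hk D s) x)⁻¹ • L) (EuclideanSpace.single i 1) := by
        change _ = (cvl p (hk D s) x)⁻¹ * L (EuclideanSpace.single i 1)
        rw [hLi]; ring
      rw [e0]
      exact h1
    have h2 : ∀ x, HasLineDerivAt ℝ (cvl p (hki D s i))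
        (cvl p (hkii D s i) x) x (EuclideanSpace.single i 1) := by
      intro x
      obtain ⟨L, hL, hLi⟩ := psi_hasFDerivAt hp hs i x
      rw [← hLi]
      exact hL.hasLineDerivAt _
    have e : ∀ x, cvl p (hki D s i) x ^ 2 / cvl p (hk D s) x =
        cvl p (hki D s i) x / cvl p (hk D s) x * cvl p (hki D s i) x := fun x => by ring
    have hJi' := hJi i
    simp_rw [e] at hJi' ⊢
    exact integral_bilinear_hasLineDerivAt_right_eq_neg_left_of_integrable
      (B := ContinuousLinearMap.mul ℝ ℝ) hJi' (hii i) (hi i) (fun x _ => h1 x) (fun x _ => h2 x)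
  unfold fisherInfo
  simp_rw [fisher_integrand hp hp0 hp1 hs, psii_sum hp hs]
  rw [integral_finsetSum _ fun i _ => hJi i]
  have e2 : ∀ x, (1 + Real.log (cvl p (hk D s) x)) * (1 / 2 * ∑ i, cvl p (hkii D s i) x) =
      1 / 2 * ∑ i, (1 + Real.log (cvl p (hk D s) x)) * cvl p (hkii D s i) x := fun x => by
    rw [← Finset.mul_sum]; ring
  simp_rw [e2]
  rw [integral_const_mul, integral_finsetSum _ fun i _ => hii i]
  simp_rw [key]
  rw [Finset.sum_neg_distrib]
  ring

lemma entropy_deriv {p : 𝕍 → ℝ} (hp : Integrable p) (hp0 : ∀ x, 0 ≤ p x) (hp1 : ∫ x, p x = 1)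
    (hpm : Integrable (fun x => ‖x‖ ^ 2 * p x)) {s : ℝ} (hs : 0 < s)
    (hJ : Integrable (fun x => cvl p (hk D s) x *
        ‖gradient (fun y => Real.log (cvl p (hk D s) y)) x‖ ^ 2))
    (hH : Integrable (fun x => cvl p (hk D s) x * Real.log (cvl p (hk D s) x))) :
    HasDerivAt (fun s => diffEntropy (cvl p (hk D s))) (1 / 2 * fisherInfo (cvl p (hk D s))) s := by
  have hlt : s / 2 ≤ 2 * s := by linarith
  have hs2 : 0 < s / 2 := by linarith
  obtain ⟨C, c, hC, hc, h⟩ := hkt_unif (D := D) hs2 hlt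
  obtain ⟨C2, hC2, h2⟩ := ps_log_bound hp hp0 hp1 hs2 hlt
  obtain ⟨G, hG, h3⟩ := cvl_weight hp hp0 hpm hC hc
  have hn : Icc (s / 2) (2 * s) ∈ 𝓝 s := Icc_mem_nhds (by linarith) (by linarith)
  have hlog : ∀ r, 0 < r → Continuous (fun x => Real.log (cvl p (hk D r) x)) := fun r hr =>
    (ps_cont hp hr).log fun x => (ps_pos hp hp0 hp1 hr x).ne'
  have main := (hasDerivAt_integral_of_dominated_loc_of_deriv_le (s := Icc (s / 2) (2 * s))
    (F := fun r x => cvl p (hk D r) x * Real.log (cvl p (hk D r) x))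
    (F' := fun r x => (1 + Real.log (cvl p (hk D r) x)) * cvl p (hkt D r) x)
    (bound := fun x => C2 * G x) (μ := volume) hn ?_ hH ?_ ?_ (hG.const_mul C2) ?_).2
  · rw [ibp hp hp0 hp1 hpm hs hJ] at main
    have := main.neg
    rw [neg_neg] at this
    exact this
  · filter_upwards [lt_mem_nhds hs] with r hr
    have h5 := hlog r hr
    have h6 := ps_cont hp hr
    exact (h6.mul h5).aestronglyMeasurable
  · have h5 := hlog s hs
    have h6 := pst_cont hp hs
    exact ((continuous_const.add h5).mul h6).aestronglyMeasurable
  · refine Eventually.of_forall fun x r hr => ?_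
    rw [norm_mul, Real.norm_eq_abs, Real.norm_eq_abs]
    calc |1 + Real.log (cvl p (hk D r) x)| * |cvl p (hkt D r) x|
        ≤ (C2 * (1 + ‖x‖ ^ 2)) * |cvl p (hkt D r) x| := by
          gcongr; exact h2 r hr x
      _ = C2 * ((1 + ‖x‖ ^ 2) * |cvl p (hkt D r) x|) := by ring
      _ ≤ C2 * G x := by gcongr; exact h3 _ (hkt_cont r) (h r hr) x
  · refine Eventually.of_forall fun x r hr => ?_
    have hr0 : 0 < r := hs2.trans_le hr.1
    have h5 := ps_hasDerivAt hp hr0 x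
    have hpos := ps_pos hp hp0 hp1 hr0 x
    refine (h5.mul (h5.log hpos.ne')).congr_deriv ?_
    field_simp
    ring

/-! ### continuity of the entropy at time zero -/

lemma jensen_tangent {t u : ℝ} (ht : 0 ≤ t) (hu : 0 < u) :
    u * Real.log u + (1 + Real.log u) * (t - u) ≤ t * Real.log t := by
  rcases ht.eq_or_lt with rfl | ht
  · simp; nlinarith
  · have h1 := Real.log_le_sub_one_of_pos (div_pos hu ht)
    rw [Real.log_div hu.ne' ht.ne'] at h1
    have h2 : t * (Real.log u - Real.log t) ≤ t * (u / t - 1) := by gcongr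
    have h3 : t * (u / t - 1) = u - t := by field_simp
    nlinarith

lemma hk_bdd {s : ℝ} (hs : 0 < s) : ∃ C : ℝ, ∀ z : 𝕍, |hk D s z| ≤ C := by
  obtain ⟨C, hC, h⟩ := poly_hk_bdd (D := D) hs
  exact ⟨1 * C, fun z => (hk_bound' hs z).trans (by gcongr; exact h z)⟩

lemma hk_shift_integrable {s : ℝ} (hs : 0 < s) (x : 𝕍) :
    Integrable (fun y => hk D s (x - y)) := (hk_integrable hs).comp_sub_left x

lemma hk_shift_integral {s : ℝ} (hs : 0 < s) (x : 𝕍) : ∫ y, hk D s (x - y) = 1 := by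
  rw [integral_sub_left_eq_self (hk D s) volume x, hk_integral hs]

lemma entropy_upper {p : 𝕍 → ℝ} (hp : Integrable p) (hp0 : ∀ x, 0 ≤ p x) (hp1 : ∫ x, p x = 1)
    (hH0 : Integrable (fun x => p x * Real.log (p x))) {s : ℝ} (hs : 0 < s)
    (hH : Integrable (fun x => cvl p (hk D s) x * Real.log (cvl p (hk D s) x))) :
    ∫ x, cvl p (hk D s) x * Real.log (cvl p (hk D s) x) ≤ ∫ x, p x * Real.log (p x) := by
  obtain ⟨C, hC⟩ := hk_bdd (D := D) hs
  have h1 : ∫ x, cvl (fun y => p y * Real.log (p y)) (hk D s) x = ∫ x, p x * Real.log (p x) := by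
    rw [cvl_integral hH0 (hk_integrable hs), hk_integral hs, mul_one]
  rw [← h1]
  refine integral_mono hH (cvl_integrable hH0 (hk_integrable hs)) fun x => ?_
  have hu := ps_pos hp hp0 hp1 hs x
  beta_reduce
  set u := cvl p (hk D s) x with hudef
  have i1 := ps_integrand hp hs x
  have i2 := hk_shift_integrable (D := D) hs x
  have e : u * Real.log u = ∫ y, (u * Real.log u * hk D s (x - y) +
      (1 + Real.log u) * (p y * hk D s (x - y) - u * hk D s (x - y))) := by
    have i3 : Integrable (fun y => p y * hk D s (x - y) - u * hk D s (x - y)) :=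
      i1.sub (i2.const_mul u)
    rw [integral_add (i2.const_mul _) (i3.const_mul _),
      integral_const_mul, integral_const_mul, integral_sub i1 (i2.const_mul _), integral_const_mul,
      hk_shift_integral hs]
    have : ∫ y, p y * hk D s (x - y) = u := rfl
    rw [this]; ring
  rw [e]
  refine integral_mono ((i2.const_mul _).add ((i1.sub (i2.const_mul _)).const_mul _))
    (integrand_integrable hH0 (hk_cont s) hC x) fun y => ?_
  have := mul_le_mul_of_nonneg_right (jensen_tangent (hp0 y) hu) (hk_pos hs (x - y)).le
  beta_reduce
  linarith

lemma sq_hk {s : ℝ} (hs : 0 < s) (z : 𝕍) :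
    ‖z‖ ^ 2 * hk D s z ≤ 4 * s * 2 ^ ((D : ℝ) / 2) * hk D (2 * s) z := by
  have h1 : ‖z‖ ^ 2 / (4 * s) ≤ Real.exp (‖z‖ ^ 2 / (4 * s)) := by
    linarith [Real.add_one_le_exp (‖z‖ ^ 2 / (4 * s))]
  have h2 : ‖z‖ ^ 2 ≤ 4 * s * Real.exp (‖z‖ ^ 2 / (4 * s)) := by
    rw [div_le_iff₀ (by positivity)] at h1; linarith
  have e1 : Real.exp (-‖z‖ ^ 2 / (2 * (2 * s))) =
      Real.exp (‖z‖ ^ 2 / (4 * s)) * Real.exp (-‖z‖ ^ 2 / (2 * s)) := by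
    rw [← Real.exp_add]; congr 1; field_simp; ring
  have e2 : (2 * π * (2 * s)) ^ (-(D : ℝ) / 2) =
      2 ^ (-(D : ℝ) / 2) * (2 * π * s) ^ (-(D : ℝ) / 2) := by
    rw [← Real.mul_rpow (by positivity) (by positivity)]; congr 1; ring
  have e3 : (2 : ℝ) ^ ((D : ℝ) / 2) * 2 ^ (-(D : ℝ) / 2) = 1 := by
    rw [← Real.rpow_add (by positivity)]; convert Real.rpow_zero _ using 2; ring
  have e4 : 4 * s * 2 ^ ((D : ℝ) / 2) * hk D (2 * s) z =
      (4 * s * Real.exp (‖z‖ ^ 2 / (4 * s))) * hk D s z := by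
    unfold hk
    rw [e1, e2]
    calc _ = ((2 : ℝ) ^ ((D : ℝ) / 2) * 2 ^ (-(D : ℝ) / 2)) * (4 * s * Real.exp (‖z‖ ^ 2 / (4 * s)) *
          ((2 * π * s) ^ (-(D : ℝ) / 2) * Real.exp (-‖z‖ ^ 2 / (2 * s)))) := by ring
      _ = _ := by rw [e3, one_mul]
  rw [e4]
  exact mul_le_mul_of_nonneg_right h2 (hk_pos hs z).le

lemma moment_bound {p : 𝕍 → ℝ} (hp : Integrable p) (hp0 : ∀ x, 0 ≤ p x) (hp1 : ∫ x, p x = 1)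
    (hpm : Integrable (fun x => ‖x‖ ^ 2 * p x)) {s : ℝ} (hs : 0 < s) :
    Integrable (fun x => ‖x‖ ^ 2 * cvl p (hk D s) x) ∧
    ∫ x, ‖x‖ ^ 2 * cvl p (hk D s) x ≤ (1 + √s) * (∫ x, ‖x‖ ^ 2 * p x) +
      (s + √s) * (4 * 2 ^ ((D : ℝ) / 2)) := by
  have hs2 : 0 < 2 * s := by linarith
  have hr : 0 < √s := Real.sqrt_pos.2 hs
  have hrs : √s * √s = s := Real.mul_self_sqrt hs.le
  obtain ⟨C, hC⟩ := hk_bdd (D := D) hs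
  obtain ⟨C2, hC2⟩ := hk_bdd (D := D) hs2
  set A : ℝ := 4 * 2 ^ ((D : ℝ) / 2) with hA
  have hA0 : 0 < A := by positivity
  have iG : Integrable (fun x => (1 + √s) * cvl (fun y => ‖y‖ ^ 2 * p y) (hk D s) x +
      (s + √s) * A * cvl p (hk D (2 * s)) x) :=
    ((cvl_integrable hpm (hk_integrable hs)).const_mul _).add
      ((cvl_integrable hp (hk_integrable hs2)).const_mul _)
  have hle : ∀ x : 𝕍, ‖x‖ ^ 2 * cvl p (hk D s) x ≤
      (1 + √s) * cvl (fun y => ‖y‖ ^ 2 * p y) (hk D s) x +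
      (s + √s) * A * cvl p (hk D (2 * s)) x := by
    intro x
    unfold cvl
    have j1 := integrand_integrable hpm (hk_cont s) hC x
    have j2 := ps_integrand hp hs2 x
    rw [← integral_const_mul, ← integral_const_mul, ← integral_const_mul,
      ← integral_add (j1.const_mul _) (j2.const_mul _)]
    refine integral_mono ((ps_integrand hp hs x).const_mul _)
      ((j1.const_mul _).add (j2.const_mul _)) fun y => ?_
    have h1 : ‖x‖ ^ 2 ≤ (1 + √s) * ‖y‖ ^ 2 + (1 + 1 / √s) * ‖x - y‖ ^ 2 := by
      have h0 : ‖x‖ ≤ ‖y‖ + ‖x - y‖ := by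
        have := norm_add_le y (x - y); simpa using this
      have h2 : ‖x‖ ^ 2 ≤ (‖y‖ + ‖x - y‖) ^ 2 := by gcongr
      have h3 : 0 ≤ (1 / √s) * (√s * ‖y‖ - ‖x - y‖) ^ 2 := by positivity
      have h4 : (1 / √s) * (√s * ‖y‖ - ‖x - y‖) ^ 2 =
          √s * ‖y‖ ^ 2 - 2 * ‖y‖ * ‖x - y‖ + 1 / √s * ‖x - y‖ ^ 2 := by
        field_simp; ring
      nlinarith
    have h5 := sq_hk (D := D) hs (x - y)
    have hpy := hp0 y
    have hkp := hk_pos (D := D) hs (x - y)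
    have e1 : (1 + 1 / √s) * s = s + √s := by
      nth_rewrite 2 [← hrs]
      field_simp
      nlinarith [hrs]
    calc ‖x‖ ^ 2 * (p y * hk D s (x - y))
        ≤ ((1 + √s) * ‖y‖ ^ 2 + (1 + 1 / √s) * ‖x - y‖ ^ 2) * (p y * hk D s (x - y)) := by
          gcongr
      _ = (1 + √s) * (‖y‖ ^ 2 * p y * hk D s (x - y)) +
          (1 + 1 / √s) * p y * (‖x - y‖ ^ 2 * hk D s (x - y)) := by ring
      _ ≤ (1 + √s) * (‖y‖ ^ 2 * p y * hk D s (x - y)) +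
          (1 + 1 / √s) * p y * (4 * s * 2 ^ ((D : ℝ) / 2) * hk D (2 * s) (x - y)) := by
          gcongr
      _ = (1 + √s) * (‖y‖ ^ 2 * p y * hk D s (x - y)) +
          ((1 + 1 / √s) * s) * A * (p y * hk D (2 * s) (x - y)) := by rw [hA]; ring
      _ = _ := by rw [e1]
  have iM : Integrable (fun x => ‖x‖ ^ 2 * cvl p (hk D s) x) := by
    have := ps_cont hp hs
    refine iG.mono' (by fun_prop) (Eventually.of_forall fun x => ?_)
    rw [Real.norm_eq_abs, abs_of_nonneg (mul_nonneg (by positivity) (ps_pos hp hp0 hp1 hs x).le)]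
    exact hle x
  refine ⟨iM, (integral_mono iM iG hle).trans (le_of_eq ?_)⟩
  rw [integral_add ((cvl_integrable hpm (hk_integrable hs)).const_mul _)
      ((cvl_integrable hp (hk_integrable hs2)).const_mul _), integral_const_mul,
      integral_const_mul, cvl_integral hpm (hk_integrable hs), cvl_integral hp (hk_integrable hs2),
      hk_integral hs, hk_integral hs2, hp1]
  ring

lemma ps_tendsto {p : 𝕍 → ℝ} (hp : Integrable p) (hpc : Continuous p) (x : 𝕍) :
    Tendsto (fun s => cvl p (hk D s) x) (𝓝[>] 0) (𝓝 (p x)) := by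
  have hfin : Module.finrank ℝ 𝕍 = D := by simp
  have hdec : Tendsto (fun z : 𝕍 => ‖z‖ ^ Module.finrank ℝ 𝕍 * hk D 1 z)
      (Bornology.cobounded 𝕍) (𝓝 0) := by
    have h1 : Tendsto (fun r : ℝ => r ^ D * Real.exp (-r)) atTop (𝓝 0) :=
      Real.tendsto_pow_mul_exp_neg_atTop_nhds_zero D
    have h2 := (h1.comp (tendsto_norm_cobounded_atTop (E := 𝕍))).const_mul
      ((2 * π * 1) ^ (-(D : ℝ) / 2) * Real.exp 1)
    rw [mul_zero] at h2
    refine squeeze_zero (fun z => mul_nonneg (by positivity) (hk_pos one_pos z).le) (fun z => ?_) h2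
    rw [hfin]
    unfold hk
    have h3 : Real.exp (-‖z‖ ^ 2 / (2 * 1)) ≤ Real.exp 1 * Real.exp (-‖z‖) := by
      rw [← Real.exp_add]
      apply Real.exp_le_exp.2
      nlinarith [sq_nonneg (‖z‖ - 1)]
    calc _ ≤ ‖z‖ ^ D * ((2 * π * 1) ^ (-(D : ℝ) / 2) * (Real.exp 1 * Real.exp (-‖z‖))) := by
          gcongr
      _ = _ := by simp only [Function.comp]; ring
  have h := tendsto_integral_comp_smul_smul_of_integrable' (μ := (volume : Measure 𝕍))
    (fun z => (hk_pos (D := D) one_pos z).le) (hk_integral one_pos) hdec hp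
    (hpc.continuousAt (x := x))
  have hlim : Tendsto (fun s : ℝ => (√s)⁻¹) (𝓝[>] 0) atTop := by
    apply Tendsto.inv_tendsto_nhdsGT_zero
    refine tendsto_nhdsWithin_iff.2 ⟨?_, ?_⟩
    · have := (Real.continuous_sqrt.tendsto 0).mono_left (nhdsWithin_le_nhds (s := Ioi (0 : ℝ)))
      simpa using this
    · filter_upwards [self_mem_nhdsWithin] with s hs
      exact Real.sqrt_pos.2 hs
  refine (h.comp hlim).congr' ?_
  filter_upwards [self_mem_nhdsWithin] with s hs
  have hs : 0 < s := hs
  simp only [Function.comp, cvl]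
  congr 1
  funext y
  rw [smul_eq_mul, mul_comm]
  congr 1
  rw [hfin]
  unfold hk
  have e1 : -‖(√s)⁻¹ • (x - y)‖ ^ 2 / (2 * 1) = -‖x - y‖ ^ 2 / (2 * s) := by
    rw [norm_smul, mul_pow, norm_inv, inv_pow, Real.norm_eq_abs, sq_abs, Real.sq_sqrt hs.le]
    field_simp
  have e2 : (√s)⁻¹ ^ D = s ^ (-(D : ℝ) / 2) := by
    rw [Real.sqrt_eq_rpow, ← Real.rpow_neg hs.le, ← Real.rpow_natCast, ← Real.rpow_mul hs.le]
    congr 1; ring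
  rw [e1, e2, ← mul_assoc, ← Real.mul_rpow hs.le (by positivity)]
  congr 2; ring

lemma entropy_nonneg {t m : ℝ} (ht : 0 ≤ t) :
    0 ≤ t * Real.log t + m * t + Real.exp (-m) := by
  have := jensen_tangent ht (Real.exp_pos (-m))
  rw [Real.log_exp] at this
  nlinarith [Real.exp_pos (-m), mul_nonneg ht (Real.exp_pos (-m)).le]

lemma entropy_tendsto {p : 𝕍 → ℝ} (hp : Integrable p) (hpc : Continuous p) (hp0 : ∀ x, 0 ≤ p x)
    (hp1 : ∫ x, p x = 1) (hpm : Integrable (fun x => ‖x‖ ^ 2 * p x))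
    (hH0 : Integrable (fun x => p x * Real.log (p x))) {s₁ : ℝ} (hs₁ : 0 < s₁)
    (hH : ∀ s ∈ Ioc 0 s₁,
      Integrable (fun x => cvl p (hk D s) x * Real.log (cvl p (hk D s) x))) :
    Tendsto (fun s => ∫ x, cvl p (hk D s) x * Real.log (cvl p (hk D s) x)) (𝓝[>] 0)
      (𝓝 (∫ x, p x * Real.log (p x))) := by
  have hmem : ∀ᶠ s in 𝓝[>] (0 : ℝ), s ∈ Ioc 0 s₁ := Ioc_mem_nhdsGT hs₁
  have ieg := eg_integrable (D := D) one_pos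
  set h0 : 𝕍 → ℝ := fun x => p x * Real.log (p x) + ‖x‖ ^ 2 * p x + eg D 1 x with hh0
  set h : ℝ → 𝕍 → ℝ := fun s x => cvl p (hk D s) x * Real.log (cvl p (hk D s) x) +
    ‖x‖ ^ 2 * cvl p (hk D s) x + eg D 1 x with hh
  have ih0 : Integrable h0 := (hH0.add hpm).add ieg
  have ih : ∀ s ∈ Ioc 0 s₁, Integrable (h s) := fun s hs =>
    ((hH s hs).add (moment_bound hp hp0 hp1 hpm hs.1).1).add ieg
  have nn0 : ∀ x, 0 ≤ h0 x := fun x => by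
    have := entropy_nonneg (m := ‖x‖ ^ 2) (hp0 x)
    simpa [hh0, eg] using this
  have nn : ∀ s, 0 < s → ∀ x, 0 ≤ h s x := fun s hs x => by
    have := entropy_nonneg (m := ‖x‖ ^ 2) (ps_pos hp hp0 hp1 hs x).le
    simpa [hh, eg] using this
  have hmin : Tendsto (fun s => ∫ x, min (h s x) (h0 x)) (𝓝[>] 0) (𝓝 (∫ x, h0 x)) := by
    refine tendsto_integral_filter_of_dominated_convergence h0 ?_ ?_ ih0 ?_
    · filter_upwards [hmem] with s hs
      exact ((ih s hs).inf ih0).aestronglyMeasurable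
    · filter_upwards [hmem] with s hs
      refine Eventually.of_forall fun x => ?_
      rw [Real.norm_eq_abs, abs_of_nonneg (le_min (nn s hs.1 x) (nn0 x))]
      exact min_le_right _ _
    · refine Eventually.of_forall fun x => ?_
      have t1 := ps_tendsto hp hpc x
      have t2 : Tendsto (fun s => cvl p (hk D s) x * Real.log (cvl p (hk D s) x)) (𝓝[>] 0)
          (𝓝 (p x * Real.log (p x))) := (Real.continuous_mul_log.tendsto (p x)).comp t1
      have t3 : Tendsto (fun s => h s x) (𝓝[>] 0) (𝓝 (h0 x)) :=
        (t2.add (t1.const_mul (‖x‖ ^ 2))).add_const _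
      have := t3.min (tendsto_const_nhds (x := h0 x))
      simpa using this
  have hsq : Tendsto (fun s : ℝ => √s) (𝓝[>] 0) (𝓝 0) := by
    have := (Real.continuous_sqrt.tendsto 0).mono_left (nhdsWithin_le_nhds (s := Ioi (0 : ℝ)))
    simpa using this
  have hid : Tendsto (fun s : ℝ => s) (𝓝[>] 0) (𝓝 0) := nhdsWithin_le_nhds
  have hlow : Tendsto (fun s => (∫ x, min (h s x) (h0 x)) - ((1 + √s) * (∫ x, ‖x‖ ^ 2 * p x) +
      (s + √s) * (4 * 2 ^ ((D : ℝ) / 2))) - ∫ x, eg D 1 x) (𝓝[>] 0)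
      (𝓝 (∫ x, p x * Real.log (p x))) := by
    have e : ∫ x, p x * Real.log (p x) = (∫ x, h0 x) - ((1 + 0) * (∫ x, ‖x‖ ^ 2 * p x) +
      (0 + 0) * (4 * 2 ^ ((D : ℝ) / 2))) - ∫ x, eg D 1 x := by
      have : ∫ x, h0 x = (∫ x, p x * Real.log (p x)) + (∫ x, ‖x‖ ^ 2 * p x) + ∫ x, eg D 1 x := by
        have i12 : Integrable (fun x => p x * Real.log (p x) + ‖x‖ ^ 2 * p x) := hH0.add hpm
        rw [← integral_add hH0 hpm, ← integral_add i12 ieg]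
      rw [this]; ring
    rw [e]
    exact (hmin.sub (((hsq.const_add 1).mul_const _).add ((hid.add hsq).mul_const _))).sub_const _
  refine tendsto_of_tendsto_of_tendsto_of_le_of_le' hlow tendsto_const_nhds ?_ ?_
  · filter_upwards [hmem] with s hs
    obtain ⟨im, hm⟩ := moment_bound hp hp0 hp1 hpm hs.1
    have e : ∫ x, h s x = (∫ x, cvl p (hk D s) x * Real.log (cvl p (hk D s) x)) +
        (∫ x, ‖x‖ ^ 2 * cvl p (hk D s) x) + ∫ x, eg D 1 x := by
      have i12 : Integrable (fun x => cvl p (hk D s) x * Real.log (cvl p (hk D s) x) +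
          ‖x‖ ^ 2 * cvl p (hk D s) x) := (hH s hs).add im
      rw [← integral_add (hH s hs) im, ← integral_add i12 ieg]
    have : ∫ x, min (h s x) (h0 x) ≤ ∫ x, h s x :=
      integral_mono ((ih s hs).inf ih0) (ih s hs) fun x => min_le_left _ _
    linarith
  · filter_upwards [hmem] with s hs
    exact entropy_upper hp hp0 hp1 hH0 hs.1 (hH s hs)

end

/-- integrated de Bruijn identity:
`H(p_{σ₁²}) − H(p) = (1/2) ∫₀^{σ₁²} J(p_{σ²}) dσ²`. -/
theorem integrated_deBruijn
    (D : ℕ) (p : EuclideanSpace ℝ (Fin D) → ℝ) (s₁ : ℝ) (hs₁ : 0 < s₁)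
    -- p is a twice continuously differentiable probability density
    (hp2 : ContDiff ℝ 2 p)
    (hp0 : ∀ x, 0 ≤ p x) (hp1 : ∫ x, p x = 1)
    -- finite second moment
    (hpmom : Integrable (fun x => ‖x‖ ^ 2 * p x))
    -- J(p_{σ²}) is finite and continuous in σ² on [0, σ₁²]
    (hJfin : ∀ s ∈ Icc (0 : ℝ) s₁,
      Integrable (fun x => gaussSmooth p s x *
        ‖gradient (fun y => Real.log (gaussSmooth p s y)) x‖ ^ 2))
    (hJcont : ContinuousOn (fun s => fisherInfo (gaussSmooth p s)) (Icc (0 : ℝ) s₁))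
    -- H(p_{σ²}) is finite on [0, σ₁²]
    (hHfin : ∀ s ∈ Icc (0 : ℝ) s₁,
      Integrable (fun x => gaussSmooth p s x * Real.log (gaussSmooth p s x))) :
    diffEntropy (gaussSmooth p s₁) - diffEntropy p =
      (1 / 2) * ∫ s in (0 : ℝ)..s₁, fisherInfo (gaussSmooth p s) := by
  have hp : Integrable p := by
    by_contra h
    rw [integral_undef h] at hp1
    exact zero_ne_one hp1
  have hJ : ∀ s ∈ Ioc 0 s₁, Integrable (fun x => cvl p (hk D s) x *
        ‖gradient (fun y => Real.log (cvl p (hk D s) y)) x‖ ^ 2) := fun s hs => by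
    have := hJfin s ⟨hs.1.le, hs.2⟩
    rwa [gaussSmooth_pos_eq p hs.1] at this
  have hH : ∀ s ∈ Ioc 0 s₁, Integrable (fun x => cvl p (hk D s) x *
        Real.log (cvl p (hk D s) x)) := fun s hs => by
    have := hHfin s ⟨hs.1.le, hs.2⟩
    rwa [gaussSmooth_pos_eq p hs.1] at this
  have hH0 : Integrable (fun x => p x * Real.log (p x)) := by
    have := hHfin 0 ⟨le_rfl, hs₁.le⟩
    rwa [gaussSmooth_zero] at this
  have hev : ∀ s : ℝ, 0 < s → (fun r => diffEntropy (gaussSmooth p r)) =ᶠ[𝓝 s]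
      fun r => diffEntropy (cvl p (hk D r)) := fun s hs => by
    filter_upwards [lt_mem_nhds hs] with r hr
    rw [gaussSmooth_pos_eq p hr]
  have hder : ∀ s ∈ Ioc 0 s₁, HasDerivAt (fun r => diffEntropy (gaussSmooth p r))
      (1 / 2 * fisherInfo (gaussSmooth p s)) s := fun s hs => by
    rw [gaussSmooth_pos_eq p hs.1]
    exact (entropy_deriv hp hp0 hp1 hpmom hs.1 (hJ s hs) (hH s hs)).congr_of_eventuallyEq
      (hev s hs.1)
  have hcont : ContinuousOn (fun r => diffEntropy (gaussSmooth p r)) (Icc 0 s₁) := by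
    intro s hs
    rcases hs.1.eq_or_lt with h | h
    · subst h
      have h1 : ContinuousWithinAt (fun r => diffEntropy (gaussSmooth p r)) (Ioi 0) 0 := by
        unfold ContinuousWithinAt
        simp only [gaussSmooth_zero]
        have h2 := (entropy_tendsto hp hp2.continuous hp0 hp1 hpmom hH0 hs₁ hH).neg
        refine h2.congr' ?_
        filter_upwards [self_mem_nhdsWithin] with r hr
        rw [gaussSmooth_pos_eq p hr]
        rfl
      exact (continuousWithinAt_Ioi_iff_Ici.1 h1).mono Icc_subset_Ici_self
    · exact (hder s ⟨h, hs.2⟩).continuousAt.continuousWithinAt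
  have hint : IntervalIntegrable (fun s => 1 / 2 * fisherInfo (gaussSmooth p s)) volume 0 s₁ := by
    apply ContinuousOn.intervalIntegrable
    rw [uIcc_of_le hs₁.le]
    exact hJcont.const_mul _
  have := intervalIntegral.integral_eq_sub_of_hasDerivAt_of_le hs₁.le hcont
    (fun s hs => hder s ⟨hs.1, hs.2.le⟩) hint
  rw [intervalIntegral.integral_const_mul] at this
  rw [this]
  simp only [gaussSmooth_zero]
end
end
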